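/- arXiv:2102.02010 — 3 statements merged into one kernel-verified Lean document; each statement's English description precedes it below -/
import Mathlib

section
/- For every k ≥ 5, the inducibility of every k-vertex tree S that is neither a path nor a star is at most 1 - k^{-(2k-3)}. -/
open SimpleGraph Filter

/-- The degree of a vertex, as the cardinality of its neighbour set. -/
noncomputable def ndeg {V : Type*} (G : SimpleGraph V) (v : V) : ℕ :=
  (G.neighborSet v).ncard

/-- `Z_k(G)`: the number of `k`-vertex subtrees (connected subgraphs) of `G`. -/
noncomputable def subtreeCount {V : Type*} [Fintype V] (G : SimpleGraph V) (k : ℕ) : ℕ :=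
  {s : Finset V | s.card = k ∧ (G.induce (s : Set V)).Connected}.ncard

/-- The number of embeddings (subtrees isomorphic to `S`) of a tree `S` in `G`,
counted among `k`-vertex subtrees. -/
noncomputable def embCount {V W : Type*} [Fintype V] (G : SimpleGraph V)
    (S : SimpleGraph W) (k : ℕ) : ℕ :=
  {s : Finset V | s.card = k ∧ Nonempty ((G.induce (s : Set V)) ≃g S)}.ncard

/-- The density `d(S,T)`: the number of embeddings of the `|S|`-vertex tree `S` in `T`
divided by the number of `|S|`-vertex subtrees of `T` (`0` if `T` has fewer vertices). -/
noncomputable def density {V W : Type*} [Fintype V] [Fintype W]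
    (S : SimpleGraph W) (T : SimpleGraph V) : ℝ :=
  (embCount T S (Fintype.card W) : ℝ) / (subtreeCount T (Fintype.card W) : ℝ)

/-- `max { d(S,T) : T an n-vertex tree }`. -/
noncomputable def maxDensity {W : Type*} [Fintype W] (S : SimpleGraph W) (n : ℕ) : ℝ :=
  sSup {x : ℝ | ∃ T : SimpleGraph (Fin n), T.IsTree ∧ x = density S T}

/-- The inducibility of `S`: `limsup_{n → ∞} max { d(S,T) : T an n-vertex tree }`. -/
noncomputable def inducibility {W : Type*} [Fintype W] (S : SimpleGraph W) : ℝ :=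
  Filter.limsup (maxDensity S) Filter.atTop

/-- A graph is starlike if it has at most one non-leaf vertex. -/
def IsStarlike {V : Type*} (G : SimpleGraph V) : Prop :=
  {v | ndeg G v ≠ 1}.Subsingleton

/-- A graph is pathlike if its maximum degree is at most 2. -/
def IsPathlike {V : Type*} (G : SimpleGraph V) : Prop :=
  ∀ v, ndeg G v ≤ 2

/-- The vertex set of the component of `u` in `G - v`; together with the edge `uv`, this is
the branch of `G` rooted at `v` through its neighbour `u`. -/
def branchSet {V : Type*} (G : SimpleGraph V) (v u : V) : Set V :=
  {w | ∃ p : G.Walk u w, v ∉ p.support}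

/-- The branch of `G` rooted at `v` through `u` is non-trivial if it is not a single edge. -/
def NontrivialBranch {V : Type*} (G : SimpleGraph V) (v u : V) : Prop :=
  G.Adj v u ∧ branchSet G v u ≠ {u}

/-- The branch rooted at `v` through `u` is a fork: non-trivial and isomorphic to a star in
which `v` is a leaf (all vertices of the branch other than `u` and `v` are leaves of `G`). -/
def IsFork {V : Type*} (G : SimpleGraph V) (v u : V) : Prop :=
  NontrivialBranch G v u ∧ ∀ w ∈ branchSet G v u, w ≠ u → ndeg G w = 1

/-- The order of a fork: its number of leaves other than the root. -/
noncomputable def forkOrder {V : Type*} (G : SimpleGraph V) (v u : V) : ℕ :=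
  (branchSet G v u).ncard - 1

/-- A branch is major if it is non-trivial and not a fork. -/
def IsMajor {V : Type*} (G : SimpleGraph V) (v u : V) : Prop :=
  NontrivialBranch G v u ∧ ¬ IsFork G v u

/-- A caterpillar is a tree in which every vertex is the root of at most two
non-trivial branches. -/
def IsCaterpillar {V : Type*} (G : SimpleGraph V) : Prop :=
  G.IsTree ∧ ∀ v, {u | NontrivialBranch G v u}.ncard ≤ 2

/-- A center of `G`: each branch rooted at `v` has at most `|G|/2` edges (the branch through
a neighbour `u` has `(branchSet G v u).ncard` edges). -/
def IsCenter {V : Type*} [Fintype V] (G : SimpleGraph V) (v : V) : Prop :=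
  ∀ u, G.Adj v u → 2 * (branchSet G v u).ncard ≤ Fintype.card V

/-- `v` is the root of at least three non-trivial branches. -/
def RootsThreeNontrivial {V : Type*} (G : SimpleGraph V) (v : V) : Prop :=
  3 ≤ {u | NontrivialBranch G v u}.ncard

/-- A hub of `G`: a vertex `v` that is the only vertex on the path from `v` to the nearest
center of `G` that is the root of at least three non-trivial branches.  (A vertex `w` lies on
the path from `v` to `c` iff `dist v w + dist w c = dist v c`.) -/
def IsHub {V : Type*} [Fintype V] (G : SimpleGraph V) (v : V) : Prop :=
  RootsThreeNontrivial G v ∧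
  ∃ c, IsCenter G c ∧ (∀ c', IsCenter G c' → G.dist v c ≤ G.dist v c') ∧
    ∀ w, G.dist v w + G.dist w c = G.dist v c → w ≠ v → ¬ RootsThreeNontrivial G w

namespace SimpleGraph

variable {V : Type*} {T : SimpleGraph V}

/-- The first vertex after `a` on a shortest path from `a` to `v`. -/
lemma Connected.exists_adj_dist_add_one (hT : T.Connected) {a v : V} (h : a ≠ v) :
    ∃ c, T.Adj a c ∧ T.dist c v + 1 = T.dist a v := by
  obtain ⟨p, hp⟩ := hT.exists_walk_length_eq_dist a v
  cases p with
  | nil => exact absurd rfl h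
  | cons hadj q =>
    rename_i c
    refine ⟨c, hadj, ?_⟩
    have h1 := dist_le q
    have h2 := hT.dist_triangle (u := a) (v := c) (w := v)
    rw [dist_eq_one_iff_adj.2 hadj] at h2
    simp only [Walk.length_cons] at hp
    omega

lemma IsTree.eq_of_adj_of_dist_add_one (hT : T.IsTree) {a b c v : V} (hb : T.Adj a b)
    (hc : T.Adj a c) (hbv : T.dist b v + 1 = T.dist a v) (hcv : T.dist c v + 1 = T.dist a v) :
    b = c := by
  obtain ⟨p, hp⟩ := hT.connected.exists_walk_length_eq_dist b v
  obtain ⟨q, hq⟩ := hT.connected.exists_walk_length_eq_dist c v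
  have h1 : (Walk.cons hb p).IsPath :=
    Walk.isPath_of_length_eq_dist _ (by rw [Walk.length_cons, hp, hbv])
  have h2 : (Walk.cons hc q).IsPath :=
    Walk.isPath_of_length_eq_dist _ (by rw [Walk.length_cons, hq, hcv])
  have h3 := congrArg Subtype.val ((hT.isAcyclic.subsingleton_path _ _).elim
    (⟨_, h1⟩ : T.Path a v) ⟨_, h2⟩)
  simp only [Walk.cons.injEq] at h3
  exact h3.1

lemma IsTree.dist_add_one_or (hT : T.IsTree) {a b : V} (h : T.Adj a b) (v : V) :
    T.dist a v + 1 = T.dist b v ∨ T.dist b v + 1 = T.dist a v := by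
  have := hT.dist_eq_dist_add_one_of_adj v h
  rw [dist_comm (u := a), dist_comm (u := b)]
  omega

/-- A set of vertices closed under taking vertices of shortest paths; in a tree, these are the
vertex sets of subtrees. -/
def GeodConvex (T : SimpleGraph V) (A : Finset V) : Prop :=
  ∀ a ∈ A, ∀ b ∈ A, ∀ v, T.dist a v + T.dist v b = T.dist a b → v ∈ A

lemma GeodConvex.exists_walk_induce {A : Finset V} (hA : GeodConvex T A) (hT : T.Connected)
    (a b : (A : Set V)) : ∃ p : (T.induce (A : Set V)).Walk a b, p.length = T.dist a b := by
  induction h : T.dist (a : V) b generalizing a with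
  | zero =>
    have hab : a = b := Subtype.ext (hT.dist_eq_zero_iff.1 h)
    subst hab
    exact ⟨Walk.nil, rfl⟩
  | succ n ih =>
    have hne : (a : V) ≠ b := fun e => by simp [e] at h
    obtain ⟨c, hac, hc⟩ := hT.exists_adj_dist_add_one hne
    have hcA : c ∈ A := hA a a.2 b b.2 c (by rw [dist_eq_one_iff_adj.2 hac]; omega)
    obtain ⟨p, hp⟩ := ih ⟨c, hcA⟩ (by simp only; omega)
    exact ⟨Walk.cons (v := ⟨c, hcA⟩) (by simpa using hac) p, by rw [Walk.length_cons, hp]⟩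

lemma GeodConvex.induce_connected {A : Finset V} (hA : GeodConvex T A) (hT : T.Connected)
    (hne : A.Nonempty) : (T.induce (A : Set V)).Connected := by
  obtain ⟨a, ha⟩ := hne
  have : Nonempty (A : Set V) := ⟨⟨a, ha⟩⟩
  exact ⟨fun a b => (hA.exists_walk_induce hT a b).elim fun p _ => p.reachable⟩

lemma GeodConvex.dist_induce {A : Finset V} (hA : GeodConvex T A) (hT : T.Connected)
    (a b : (A : Set V)) : (T.induce (A : Set V)).dist a b = T.dist a b := by
  obtain ⟨p, hp⟩ := hA.exists_walk_induce hT a b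
  refine le_antisymm (hp ▸ dist_le p) ?_
  obtain ⟨q, hq⟩ := p.reachable.exists_walk_length_eq_dist
  rw [← hq]
  exact (dist_le (q.map (Embedding.induce (G := T) (A : Set V)).toHom)).trans
    (Walk.length_map _ _).le

lemma IsTree.geodConvex_of_induce_connected (hT : T.IsTree) {A : Finset V}
    (hA : (T.induce (A : Set V)).Connected) : GeodConvex T A := by
  intro a ha b hb v hv
  obtain ⟨p, hp⟩ := hA.exists_isPath ⟨a, ha⟩ ⟨b, hb⟩
  obtain ⟨q, hq⟩ := hT.connected.exists_walk_length_eq_dist a v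
  obtain ⟨r, hr⟩ := hT.connected.exists_walk_length_eq_dist v b
  have h1 : (q.append r).IsPath :=
    Walk.isPath_of_length_eq_dist _ (by rw [Walk.length_append, hq, hr, hv])
  have h2 : (p.map (Embedding.induce (G := T) (A : Set V)).toHom).IsPath :=
    hp.map (Embedding.induce (G := T) (A : Set V)).injective
  have h3 := congrArg Subtype.val ((hT.isAcyclic.subsingleton_path _ _).elim
    (⟨_, h1⟩ : T.Path a b) ⟨_, h2⟩)
  have h4 : v ∈ (q.append r).support := by simp
  have h5 : (q.append r).support =
      (p.map (Embedding.induce (G := T) (A : Set V)).toHom).support := congrArg Walk.support h3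
  rw [h5, Walk.support_map, List.mem_map] at h4
  obtain ⟨w, -, rfl⟩ := h4
  exact w.2

end SimpleGraph

namespace SimpleGraph

open Classical in
/-- The degree of `v` inside the vertex set `A`. -/
noncomputable def degIn {V : Type*} (T : SimpleGraph V) (A : Finset V) (v : V) : ℕ :=
  (A.filter (T.Adj v)).card

/-- `A` contains a vertex of degree at least three inside `A`. -/
def Branching {V : Type*} (T : SimpleGraph V) (A : Finset V) : Prop :=
  ∃ v ∈ A, 3 ≤ degIn T A v

/-- The sum of the distances from `v` to the vertices of `A`. -/
noncomputable def distSum {V : Type*} (T : SimpleGraph V) (A : Finset V) (v : V) : ℕ :=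
  ∑ a ∈ A, T.dist v a

/-- The sum of `f (dist a b)` over ordered pairs in `A`; for `f = id`, twice the Wiener index. -/
noncomputable def pairSum {V : Type*} (T : SimpleGraph V) (f : ℕ → ℕ) (A : Finset V) : ℕ :=
  ∑ a ∈ A, ∑ b ∈ A, f (T.dist a b)

variable {V : Type*} {T : SimpleGraph V} {A : Finset V} {a b u v w x y : V}

lemma eq_of_degIn_le_one (h : degIn T A x ≤ 1) (ha : a ∈ A) (hb : b ∈ A) (hxa : T.Adj x a)
    (hxb : T.Adj x b) : a = b := by
  classical
  exact Finset.card_le_one.1 h a (by simp [ha, hxa]) b (by simp [hb, hxb])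

lemma exists_adj_of_degIn_pos (h : 0 < degIn T A x) : ∃ u ∈ A, T.Adj x u := by
  classical
  obtain ⟨u, hu⟩ := Finset.card_pos.1 h
  exact ⟨u, (Finset.mem_filter.1 hu).1, (Finset.mem_filter.1 hu).2⟩

lemma degIn_eq_one (hu : u ∈ A) (hxu : T.Adj x u) (h : ∀ c ∈ A, T.Adj x c → c = u) :
    degIn T A x = 1 := by
  classical
  refine Finset.card_eq_one.2 ⟨u, ?_⟩
  ext c
  simp only [Finset.mem_filter, Finset.mem_singleton]
  exact ⟨fun hc => h c hc.1 hc.2, fun hc => hc ▸ ⟨hu, hxu⟩⟩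

namespace GeodConvex

lemma exists_adj_mem (hA : GeodConvex T A) (hT : T.Connected) (ha : a ∈ A) (hb : b ∈ A)
    (hab : a ≠ b) : ∃ c ∈ A, T.Adj a c ∧ T.dist c b + 1 = T.dist a b := by
  obtain ⟨c, hc, hcb⟩ := hT.exists_adj_dist_add_one hab
  exact ⟨c, hA a ha b hb c (by rw [dist_eq_one_iff_adj.2 hc]; omega), hc, hcb⟩

lemma degIn_pos (hA : GeodConvex T A) (hT : T.Connected) (ha : a ∈ A) (hb : b ∈ A)
    (hab : a ≠ b) : 0 < degIn T A a := by
  classical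
  obtain ⟨c, hc, hac, -⟩ := hA.exists_adj_mem hT ha hb hab
  exact Finset.card_pos.2 ⟨c, by simp [hc, hac]⟩

lemma dist_of_leaf (hA : GeodConvex T A) (hT : T.Connected) (hx : x ∈ A)
    (hx1 : degIn T A x = 1) (hu : u ∈ A) (hxu : T.Adj x u) (hv : v ∈ A) (hvx : v ≠ x) :
    T.dist x v = T.dist u v + 1 := by
  obtain ⟨c, hc, hxc, hcv⟩ := hA.exists_adj_mem hT hx hv hvx.symm
  rw [← eq_of_degIn_le_one hx1.le hc hu hxc hxu, hcv]

lemma dist_lt_of_leaf (hA : GeodConvex T A) (hT : T.Connected) (hx : x ∈ A)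
    (hx1 : degIn T A x = 1) (ha : a ∈ A) (hb : b ∈ A) (hax : a ≠ x) (hbx : b ≠ x) :
    T.dist a b < T.dist a x + T.dist x b := by
  obtain ⟨u, hu, hxu⟩ := exists_adj_of_degIn_pos (T := T) (A := A) (x := x) (by omega)
  have h1 := hA.dist_of_leaf hT hx hx1 hu hxu ha hax
  have h2 := hA.dist_of_leaf hT hx hx1 hu hxu hb hbx
  have h3 := hT.dist_triangle (u := a) (v := u) (w := b)
  rw [dist_comm (u := a) (v := u)] at h3
  rw [dist_comm (u := a) (v := x)]
  omega

lemma dist_of_adj_notMem (hA : GeodConvex T A) (hT : T.IsTree) (hw : w ∈ A) (hy : y ∉ A)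
    (hwy : T.Adj w y) (hv : v ∈ A) : T.dist y v = T.dist w v + 1 := by
  rcases hT.dist_add_one_or hwy v with h | h
  · exact h.symm
  · exact absurd (hA w hw v hv y (by rw [dist_eq_one_iff_adj.2 hwy]; omega)) hy

lemma exists_leaf_beyond (hA : GeodConvex T A) (hT : T.IsTree) (ha : a ∈ A) (hb : b ∈ A)
    (hab : a ≠ b) :
    ∃ x ∈ A, degIn T A x = 1 ∧ T.dist a x = T.dist a b + T.dist b x := by
  classical
  obtain ⟨x, hx, hmax⟩ := (A.filter fun x => T.dist a x = T.dist a b + T.dist b x).exists_max_image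
    (fun x => T.dist a x) ⟨b, by simp [hb]⟩
  rw [Finset.mem_filter] at hx
  obtain ⟨hxA, hx⟩ := hx
  have hpos := hT.connected.pos_dist_of_ne hab
  have hxa : x ≠ a := by
    rintro rfl
    rw [dist_self] at hx
    omega
  obtain ⟨c, hcA, hxc, hc⟩ := hA.exists_adj_mem hT.connected hxA ha hxa
  refine ⟨x, hxA, degIn_eq_one hcA hxc fun c' hc'A hxc' => ?_, hx⟩
  rcases hT.dist_add_one_or hxc' a with h | h
  · exfalso
    have h1 := hT.connected.dist_triangle (u := b) (v := x) (w := c')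
    have h2 := hT.connected.dist_triangle (u := a) (v := b) (w := c')
    rw [dist_eq_one_iff_adj.2 hxc'] at h1
    rw [dist_comm (v := a), dist_comm (v := a)] at h
    have h3 := hmax c' (by rw [Finset.mem_filter]; exact ⟨hc'A, by omega⟩)
    omega
  · exact hT.eq_of_adj_of_dist_add_one hxc' hxc h hc

lemma exists_off_geodesic (hT : T.IsTree) (hbr : Branching T A) (a b : V) :
    ∃ v ∈ A, T.dist a v + T.dist v b ≠ T.dist a b := by
  classical
  by_contra! hall
  obtain ⟨v, hv, h3⟩ := hbr
  obtain ⟨c₁, c₂, c₃, h1, h2, h3, h12, h13, h23⟩ := Finset.two_lt_card_iff.1 h3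
  have key : ∀ c ∈ A.filter (T.Adj v),
      T.dist c a + 1 = T.dist v a ∨ T.dist c b + 1 = T.dist v b := by
    intro c hc
    rw [Finset.mem_filter] at hc
    have e1 := hall c hc.1
    have e2 := hall v hv
    have e3 := hT.dist_add_one_or hc.2 a
    rw [dist_comm (u := a)] at e1 e2
    omega
  have uniq : ∀ z, ∀ c ∈ A.filter (T.Adj v), ∀ c' ∈ A.filter (T.Adj v),
      T.dist c z + 1 = T.dist v z → T.dist c' z + 1 = T.dist v z → c = c' := by
    intro z c hc c' hc' e e'
    exact hT.eq_of_adj_of_dist_add_one (Finset.mem_filter.1 hc).2 (Finset.mem_filter.1 hc').2 e e'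
  rcases key _ h1 with k1 | k1 <;> rcases key _ h2 with k2 | k2 <;> rcases key _ h3 with k3 | k3
  all_goals first
    | exact h12 (uniq _ _ h1 _ h2 k1 k2)
    | exact h13 (uniq _ _ h1 _ h3 k1 k3)
    | exact h23 (uniq _ _ h2 _ h3 k2 k3)

lemma dist_add_two_le_card (hA : GeodConvex T A) (hT : T.IsTree) (hbr : Branching T A)
    (ha : a ∈ A) (hb : b ∈ A) : T.dist a b + 2 ≤ A.card := by
  classical
  obtain ⟨v, hv, hoff⟩ := exists_off_geodesic hT hbr a b
  have h1 : ∀ i ≤ T.dist a b, ∃ c, T.dist a c = i ∧ T.dist a c + T.dist c b = T.dist a b := by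
    intro i
    induction i with
    | zero => exact fun _ => ⟨a, by simp⟩
    | succ i ih =>
      intro hi
      obtain ⟨c, hc, hcb⟩ := ih (by omega)
      have hne : c ≠ b := by
        rintro rfl
        omega
      obtain ⟨d, hcd, hd⟩ := hT.connected.exists_adj_dist_add_one hne
      have t1 := hT.connected.dist_triangle (u := a) (v := d) (w := b)
      have t2 := hT.connected.dist_triangle (u := a) (v := c) (w := d)
      rw [dist_eq_one_iff_adj.2 hcd] at t2
      exact ⟨d, by omega, by omega⟩
  have h2 : Finset.range (T.dist a b + 1) ⊆ (A.erase v).image (fun c => T.dist a c) := by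
    intro i hi
    obtain ⟨c, hc, hcb⟩ := h1 i (by simpa [Nat.lt_succ_iff] using hi)
    refine Finset.mem_image.2 ⟨c, Finset.mem_erase.2 ⟨?_, hA a ha b hb c hcb⟩, hc⟩
    rintro rfl
    exact hoff hcb
  have h3 := (Finset.card_le_card h2).trans Finset.card_image_le
  have h4 := Finset.card_pos.2 ⟨v, hv⟩
  rw [Finset.card_range, Finset.card_erase_of_mem hv] at h3
  omega

lemma exists_leaf_ne_ne (hA : GeodConvex T A) (hT : T.IsTree) (hbr : Branching T A)
    (ha : a ∈ A) (b : V) : ∃ x ∈ A, degIn T A x = 1 ∧ x ≠ a ∧ x ≠ b := by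
  classical
  obtain ⟨v, hv, hoff⟩ := exists_off_geodesic hT hbr a b
  obtain ⟨x, hx, hmax⟩ :=
    (A.filter fun x => T.dist a x + T.dist x b ≠ T.dist a b).exists_max_image
      (fun x => T.dist a x) ⟨v, by simp [hv, hoff]⟩
  rw [Finset.mem_filter] at hx
  obtain ⟨hxA, hx⟩ := hx
  have hxa : x ≠ a := by
    rintro rfl
    simp at hx
  have hxb : x ≠ b := by
    rintro rfl
    simp at hx
  obtain ⟨c, hcA, hxc, hc⟩ := hA.exists_adj_mem hT.connected hxA ha hxa
  refine ⟨x, hxA, degIn_eq_one hcA hxc fun c' hc'A hxc' => ?_, hxa, hxb⟩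
  rcases hT.dist_add_one_or hxc' a with h | h
  · exfalso
    rw [dist_comm (v := a), dist_comm (v := a)] at h
    have h1 := hT.connected.dist_triangle (u := x) (v := c') (w := b)
    have h2 := hT.connected.dist_triangle (u := a) (v := x) (w := b)
    rw [dist_eq_one_iff_adj.2 hxc'] at h1
    by_cases h4 : T.dist a c' + T.dist c' b = T.dist a b
    · omega
    · have h3 := hmax c' (by rw [Finset.mem_filter]; exact ⟨hc'A, h4⟩)
      omega
  · exact hT.eq_of_adj_of_dist_add_one hxc' hxc h hc

variable [DecidableEq V]

lemma erase_leaf (hA : GeodConvex T A) (hT : T.Connected) (hx : x ∈ A)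
    (hx1 : degIn T A x = 1) : GeodConvex T (A.erase x) := by
  intro a ha b hb v hv
  rw [Finset.mem_erase] at ha hb ⊢
  refine ⟨?_, hA a ha.2 b hb.2 v hv⟩
  rintro rfl
  exact (hA.dist_lt_of_leaf hT hx hx1 ha.2 hb.2 ha.1 hb.1).ne' hv

lemma insert_adj (hA : GeodConvex T A) (hT : T.IsTree) (hw : w ∈ A) (hwy : T.Adj w y) :
    GeodConvex T (insert y A) := by
  by_cases hy : y ∈ A
  · rwa [Finset.insert_eq_of_mem hy]
  have key : ∀ b ∈ A, ∀ v, T.dist y v + T.dist v b = T.dist y b → v ∈ insert y A := by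
    intro b hb v hv
    by_cases hvy : v = y
    · simp [hvy]
    obtain ⟨c, hyc, hcv⟩ := hT.connected.exists_adj_dist_add_one (Ne.symm hvy)
    have h1 := hA.dist_of_adj_notMem hT hw hy hwy hb
    have h2 := hT.connected.dist_triangle (u := c) (v := v) (w := b)
    have h3 := hT.dist_add_one_or hyc b
    have hcw : c = w := hT.eq_of_adj_of_dist_add_one hyc hwy.symm (by omega) h1.symm
    subst hcw
    exact Finset.mem_insert_of_mem (hA c hw b hb v (by omega))
  intro a ha b hb v hv
  rcases Finset.mem_insert.1 ha with rfl | ha'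
  · rcases Finset.mem_insert.1 hb with rfl | hb'
    · rw [dist_self] at hv
      have : T.dist b v = 0 := by omega
      rw [← hT.connected.dist_eq_zero_iff.1 this]
      exact ha
    · exact key b hb' v hv
  · rcases Finset.mem_insert.1 hb with rfl | hb'
    · refine key a ha' v ?_
      rw [dist_comm (v := v), dist_comm (v := a), dist_comm (u := b) (v := a)]
      omega
    · exact Finset.mem_insert_of_mem (hA a ha' b hb' v hv)

end GeodConvex

end SimpleGraph

namespace SimpleGraph

variable {V : Type*} {T : SimpleGraph V} {A A' : Finset V} {a b u v w x y : V} {f : ℕ → ℕ}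

lemma degIn_mono (h : A ⊆ A') (v : V) : degIn T A v ≤ degIn T A' v := by
  classical
  exact Finset.card_le_card (Finset.filter_subset_filter _ h)

lemma pairSum_eq_of_iso (hT : T.Connected) (hA : GeodConvex T A) (hA' : GeodConvex T A')
    (φ : T.induce (A : Set V) ≃g T.induce (A' : Set V)) (f : ℕ → ℕ) :
    pairSum T f A = pairSum T f A' := by
  have hle : ∀ {X Y : Type _} {G : SimpleGraph X} {H : SimpleGraph Y} (e : G ≃g H) (s t : X),
      G.Reachable s t → H.dist (e s) (e t) ≤ G.dist s t := by
    intro X Y G H e s t hst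
    obtain ⟨p, hp⟩ := hst.exists_walk_length_eq_dist
    rw [← hp]
    exact (dist_le (p.map e.toHom)).trans (Walk.length_map _ _).le
  have hreach : ∀ {B : Finset V}, GeodConvex T B → ∀ s t : (B : Set V),
      (T.induce (B : Set V)).Reachable s t :=
    fun hB s t => (hB.exists_walk_induce hT s t).elim fun p _ => p.reachable
  have hdist : ∀ s t : (A : Set V), T.dist (φ s : V) (φ t) = T.dist s t := by
    intro s t
    rw [← hA.dist_induce hT, ← hA'.dist_induce hT]
    refine le_antisymm (hle φ s t (hreach hA s t)) ?_
    simpa using hle φ.symm (φ s) (φ t) (hreach hA' _ _)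
  have hsum : ∀ (B : Finset V), pairSum T f B =
      ∑ s : (B : Set V), ∑ t : (B : Set V), f (T.dist (s : V) t) := by
    intro B
    rw [pairSum, ← Finset.sum_coe_sort B]
    refine Finset.sum_congr rfl fun s _ => ?_
    rw [← Finset.sum_coe_sort B]
    rfl
  rw [hsum, hsum, ← Equiv.sum_comp φ.toEquiv]
  refine Finset.sum_congr rfl fun s _ => ?_
  rw [← Equiv.sum_comp φ.toEquiv]
  exact Finset.sum_congr rfl fun t _ => congrArg f (hdist s t).symm

namespace GeodConvex

lemma distSum_of_adj_notMem (hA : GeodConvex T A) (hT : T.IsTree) (hw : w ∈ A) (hy : y ∉ A)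
    (hwy : T.Adj w y) : distSum T A y = distSum T A w + A.card := by
  rw [distSum, Finset.sum_congr rfl fun v hv => hA.dist_of_adj_notMem hT hw hy hwy hv,
    Finset.sum_add_distrib, Finset.sum_const, smul_eq_mul, mul_one, distSum]

lemma not_adj_of_leaf_of_leaf (hA : GeodConvex T A) (hT : T.IsTree) (hbr : Branching T A)
    (ha : a ∈ A) (ha1 : degIn T A a = 1) (hb : b ∈ A) (hb1 : degIn T A b = 1) :
    ¬ T.Adj a b := by
  intro hab
  obtain ⟨c, hc, -, hca, hcb⟩ := hA.exists_leaf_ne_ne hT hbr ha b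
  have h1 := hA.dist_of_leaf hT.connected ha ha1 hb hab hc hca
  have h2 := hA.dist_of_leaf hT.connected hb hb1 ha hab.symm hc hcb
  omega

lemma eq_of_adj_of_adj_notMem (hA : GeodConvex T A) (hT : T.IsTree) (hw : w ∈ A) (hy : y ∉ A)
    (hwy : T.Adj w y) (hv : v ∈ A) (hvy : T.Adj y v) : v = w := by
  have h := hA.dist_of_adj_notMem hT hw hy hwy hv
  rw [dist_eq_one_iff_adj.2 hvy] at h
  exact (hT.connected.dist_eq_zero_iff.1 (by omega)).symm

end GeodConvex

variable [DecidableEq V]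

lemma degIn_erase_of_not_adj (h : ¬ T.Adj v x) : degIn T (A.erase x) v = degIn T A v := by
  classical
  rw [degIn, degIn]
  congr 1
  ext c
  simp only [Finset.mem_filter, Finset.mem_erase]
  exact ⟨fun hc => ⟨hc.1.2, hc.2⟩, fun hc => ⟨⟨fun e => h (e ▸ hc.2), hc.1⟩, hc.2⟩⟩

lemma distSum_insert (hy : y ∉ A) (v : V) :
    distSum T (insert y A) v = distSum T A v + T.dist v y := by
  rw [distSum, Finset.sum_insert hy, add_comm, distSum]

lemma distSum_erase (hx : x ∈ A) (v : V) :
    distSum T (A.erase x) v + T.dist v x = distSum T A v :=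
  Finset.sum_erase_add _ _ hx

lemma distSum_swap (hx : x ∈ A) (hy : y ∉ A) (v : V) :
    distSum T (insert y (A.erase x)) v + T.dist v x = distSum T A v + T.dist v y := by
  rw [distSum_insert (fun h => hy (Finset.mem_of_mem_erase h)), ← distSum_erase hx v]
  ring

lemma pairSum_insert (hy : y ∉ A) :
    pairSum T f (insert y A) = pairSum T f A + 2 * ∑ v ∈ A, f (T.dist y v) + f 0 := by
  rw [pairSum, Finset.sum_insert hy, Finset.sum_insert hy, dist_self]
  have : ∑ a ∈ A, ∑ b ∈ insert y A, f (T.dist a b) =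
      ∑ v ∈ A, f (T.dist y v) + pairSum T f A := by
    rw [pairSum, ← Finset.sum_add_distrib]
    refine Finset.sum_congr rfl fun a _ => ?_
    rw [Finset.sum_insert hy, dist_comm]
  rw [this]
  ring

lemma card_swap (hx : x ∈ A) (hy : y ∉ A) : (insert y (A.erase x)).card = A.card := by
  rw [Finset.card_insert_of_notMem (fun h => hy (Finset.mem_of_mem_erase h)),
    Finset.card_erase_add_one hx]

namespace GeodConvex

lemma distSum_of_leaf (hA : GeodConvex T A) (hT : T.Connected) (hx : x ∈ A)
    (hx1 : degIn T A x = 1) (hu : u ∈ A) (hxu : T.Adj x u) :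
    distSum T A x + 2 = distSum T A u + A.card := by
  have h1 : distSum T (A.erase x) x = distSum T (A.erase x) u + (A.erase x).card := by
    rw [distSum, Finset.sum_congr rfl fun v hv => hA.dist_of_leaf hT hx hx1 hu hxu
      (Finset.mem_of_mem_erase hv) (Finset.ne_of_mem_erase hv),
      Finset.sum_add_distrib, Finset.sum_const, smul_eq_mul, mul_one, distSum]
  have h2 := distSum_erase (T := T) hx x
  have h3 := distSum_erase (T := T) hx u
  rw [dist_self] at h2
  rw [dist_eq_one_iff_adj.2 hxu.symm] at h3
  have h4 := Finset.card_erase_add_one hx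
  omega

lemma pairSum_swap (hA : GeodConvex T A) (hT : T.IsTree) (hx : x ∈ A) (hw : w ∈ A)
    (hy : y ∉ A) (hwy : T.Adj w y) :
    pairSum T f (insert y (A.erase x)) + 2 * ∑ v ∈ A.erase x, f (T.dist x v) =
      pairSum T f A + 2 * ∑ v ∈ A.erase x, f (T.dist w v + 1) := by
  have h1 : pairSum T f A = pairSum T f (A.erase x) +
      2 * ∑ v ∈ A.erase x, f (T.dist x v) + f 0 := by
    rw [← pairSum_insert (Finset.notMem_erase x A), Finset.insert_erase hx]
  rw [pairSum_insert (fun h => hy (Finset.mem_of_mem_erase h)), h1,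
    Finset.sum_congr rfl fun v hv => by
      rw [hA.dist_of_adj_notMem hT hw hy hwy (Finset.mem_of_mem_erase hv)]]
  ring

lemma pairSum_id_swap_eq_iff (hA : GeodConvex T A) (hT : T.IsTree) (hx : x ∈ A) (hw : w ∈ A)
    (hy : y ∉ A) (hwy : T.Adj w y) :
    pairSum T id (insert y (A.erase x)) = pairSum T id A ↔
      distSum T A x + T.dist w x + 1 = distSum T A w + A.card := by
  have h1 := hA.pairSum_swap hT hx hw hy hwy (f := id)
  simp only [id, Finset.sum_add_distrib, Finset.sum_const, smul_eq_mul, mul_one] at h1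
  have h2 := distSum_erase (T := T) hx x
  have h3 := distSum_erase (T := T) hx w
  have h4 := Finset.card_erase_add_one hx
  rw [dist_self] at h2
  unfold distSum at h2 h3 ⊢
  change _ = pairSum T id A + _ at h1
  change pairSum T id _ + _ = _ at h1
  omega

lemma degIn_eq_of_pairSum_swap_eq (hA : GeodConvex T A) (hT : T.IsTree) (hx : x ∈ A)
    (hx1 : degIn T A x = 1) (hu : u ∈ A) (hxu : T.Adj x u) (hw : w ∈ A)
    (hy : y ∉ A) (hwy : T.Adj w y)
    (h : pairSum T (fun n => if n = 2 then 1 else 0) (insert y (A.erase x)) =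
      pairSum T (fun n => if n = 2 then 1 else 0) A) :
    degIn T (A.erase x) u = degIn T (A.erase x) w := by
  classical
  have h1 := hA.pairSum_swap hT hx hw hy hwy (f := fun n => if n = 2 then 1 else 0)
  rw [h, Finset.sum_congr rfl fun v hv => by
      rw [hA.dist_of_leaf hT.connected hx hx1 hu hxu
        (Finset.mem_of_mem_erase hv) (Finset.ne_of_mem_erase hv)]] at h1
  have h2 : ∀ z, ∑ v ∈ A.erase x, (if T.dist z v + 1 = 2 then 1 else 0) =
      degIn T (A.erase x) z := by
    intro z
    rw [degIn, Finset.card_filter]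
    exact Finset.sum_congr rfl fun v _ => by simp [dist_eq_one_iff_adj]
  rw [h2, h2] at h1
  omega

end GeodConvex

/-- The numerical conditions satisfied by `w` when detaching any leaf `x` of `A` and attaching a
new leaf at `w` does not change the isomorphism type. -/
structure SwapStable (T : SimpleGraph V) (A : Finset V) (w : V) : Prop where
  distSum_eq : ∀ x ∈ A, degIn T A x = 1 → x ≠ w →
    distSum T A x + T.dist w x + 1 = distSum T A w + A.card
  degIn_eq : ∀ x ∈ A, degIn T A x = 1 → x ≠ w → ∀ u ∈ A, T.Adj x u →
    degIn T (A.erase x) u = degIn T (A.erase x) w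

lemma SwapStable.adj_of_leaf {w₁ w₂ : V} (h₁ : SwapStable T A w₁) (h₂ : SwapStable T A w₂)
    (hA : GeodConvex T A) (hT : T.IsTree) (hw₁ : w₁ ∈ A) (hw₂ : w₂ ∈ A) (hne : w₁ ≠ w₂)
    (hw₁1 : degIn T A w₁ = 1) (hw₂1 : degIn T A w₂ ≠ 1)
    (hx : x ∈ A) (hx1 : degIn T A x = 1) (hxw : x ≠ w₁) :
    T.Adj w₂ x ∧ degIn T (A.erase x) w₂ ≤ 1 := by
  have hxw₂ : x ≠ w₂ := fun e => hw₂1 (e ▸ hx1)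
  obtain ⟨u, hu, hxu⟩ := exists_adj_of_degIn_pos (T := T) (A := A) (x := x) (by omega)
  have h3 := h₁.degIn_eq x hx hx1 hxw u hu hxu
  have h4 := h₂.degIn_eq x hx hx1 hxw₂ u hu hxu
  have h5 := degIn_mono (T := T) (Finset.erase_subset x A) w₁
  refine ⟨?_, by omega⟩
  by_contra hnadj
  have h6 := degIn_erase_of_not_adj (A := A) hnadj
  have h7 := hA.degIn_pos hT.connected hw₂ hw₁ hne.symm
  omega

lemma SwapStable.false_of_leaf_of_not_leaf {w₁ w₂ : V} (h₁ : SwapStable T A w₁)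
    (h₂ : SwapStable T A w₂) (hA : GeodConvex T A) (hT : T.IsTree) (hbr : Branching T A)
    (hw₁ : w₁ ∈ A) (hw₂ : w₂ ∈ A) (hne : w₁ ≠ w₂) (hw₁1 : degIn T A w₁ = 1)
    (hw₂1 : degIn T A w₂ ≠ 1) : False := by
  obtain ⟨x, hx, hx1, hxw, -⟩ := hA.exists_leaf_ne_ne hT hbr hw₁ w₁
  obtain ⟨x', hx', hx'1, hx'x, hx'w⟩ := hA.exists_leaf_ne_ne hT hbr hx w₁
  obtain ⟨hadj, hle⟩ := h₁.adj_of_leaf h₂ hA hT hw₁ hw₂ hne hw₁1 hw₂1 hx hx1 hxw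
  obtain ⟨hadj', -⟩ := h₁.adj_of_leaf h₂ hA hT hw₁ hw₂ hne hw₁1 hw₂1 hx' hx'1 hx'w
  obtain ⟨c, hc, hwc, hcd⟩ := hA.exists_adj_mem hT.connected hw₂ hw₁ hne.symm
  have hfar : ∀ z ∈ A, degIn T A z = 1 → z ≠ w₁ → T.Adj w₂ z → c ≠ z := by
    rintro z hz hz1 hzw hwz rfl
    have := hA.dist_of_leaf hT.connected hz hz1 hw₂ hwz.symm hw₁ hzw.symm
    omega
  exact hfar x' hx' hx'1 hx'w hadj' (eq_of_degIn_le_one hle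
    (Finset.mem_erase.2 ⟨hfar x hx hx1 hxw hadj, hc⟩) (Finset.mem_erase.2 ⟨hx'x, hx'⟩) hwc hadj')

lemma SwapStable.eq {w₁ w₂ : V} (h₁ : SwapStable T A w₁)
    (h₂ : SwapStable T A w₂) (hA : GeodConvex T A) (hT : T.IsTree) (hbr : Branching T A)
    (hw₁ : w₁ ∈ A) (hw₂ : w₂ ∈ A) : w₁ = w₂ := by
  by_contra hne
  by_cases d₁ : degIn T A w₁ = 1 <;> by_cases d₂ : degIn T A w₂ = 1
  · have e1 := h₁.distSum_eq w₂ hw₂ d₂ (Ne.symm hne)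
    have e2 := h₂.distSum_eq w₁ hw₁ d₁ hne
    have e3 := hA.dist_add_two_le_card hT hbr hw₁ hw₂
    rw [dist_comm (u := w₂)] at e2
    omega
  · exact h₁.false_of_leaf_of_not_leaf h₂ hA hT hbr hw₁ hw₂ hne d₁ d₂
  · exact h₂.false_of_leaf_of_not_leaf h₁ hA hT hbr hw₂ hw₁ (Ne.symm hne) d₂ d₁
  · obtain ⟨x, hx, hx1, hxd⟩ := hA.exists_leaf_beyond hT hw₁ hw₂ hne
    obtain ⟨z, hz, hz1, hzd⟩ := hA.exists_leaf_beyond hT hw₂ hw₁ (Ne.symm hne)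
    have e1 := h₁.distSum_eq x hx hx1 (fun e => d₁ (e ▸ hx1))
    have e2 := h₂.distSum_eq x hx hx1 (fun e => d₂ (e ▸ hx1))
    have e3 := h₁.distSum_eq z hz hz1 (fun e => d₁ (e ▸ hz1))
    have e4 := h₂.distSum_eq z hz hz1 (fun e => d₂ (e ▸ hz1))
    have e5 := hT.connected.pos_dist_of_ne hne
    rw [dist_comm (u := w₂) (v := w₁)] at hzd
    omega

end SimpleGraph

namespace SimpleGraph

variable {V : Type*} [DecidableEq V] {T : SimpleGraph V} {A : Finset V} {a b u v w x x' y : V}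

lemma GeodConvex.degIn_swap_eq_one (hA : GeodConvex T A) (hT : T.IsTree) (hbr : Branching T A)
    (hw : w ∈ A) (hy : y ∉ A) (hwy : T.Adj w y) (hx : x ∈ A) (hx1 : degIn T A x = 1)
    (hx' : x' ∈ A) (hx'1 : degIn T A x' = 1) (hx'w : x' ≠ w) :
    degIn T (insert y (A.erase x)) x' = 1 := by
  obtain ⟨u, hu, hxu⟩ := exists_adj_of_degIn_pos (T := T) (A := A) (x := x') (by omega)
  refine degIn_eq_one (u := u) (Finset.mem_insert_of_mem (Finset.mem_erase.2 ⟨?_, hu⟩)) hxu ?_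
  · rintro rfl
    exact hA.not_adj_of_leaf_of_leaf hT hbr hx' hx'1 hx hx1 hxu
  · intro c hc hxc
    rcases Finset.mem_insert.1 hc with rfl | hc
    · exact absurd (hA.eq_of_adj_of_adj_notMem hT hw hy hwy hx' hxc.symm) hx'w
    · exact eq_of_degIn_le_one hx'1.le (Finset.mem_of_mem_erase hc) hu hxc hxu

/-- After moving a suitable leaf to a new neighbour `y` of `w`, some further leaf cannot be moved
to a neighbour of `y` without changing the Wiener index. -/
lemma SwapStable.exists_swap_at_new (h : SwapStable T A w) (hA : GeodConvex T A) (hT : T.IsTree)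
    (hbr : Branching T A) (hk : 4 ≤ A.card) (hw : w ∈ A) (hy : y ∉ A) (hwy : T.Adj w y) :
    ∃ x ∈ A, degIn T A x = 1 ∧ x ≠ w ∧ ∃ x' ∈ insert y (A.erase x),
      degIn T (insert y (A.erase x)) x' = 1 ∧ x' ≠ y ∧
      distSum T (insert y (A.erase x)) x' + T.dist y x' + 1 ≠
        distSum T (insert y (A.erase x)) y + A.card := by
  have hDy := hA.distSum_of_adj_notMem hT hw hy hwy
  have hdy : ∀ v ∈ A, T.dist y v = T.dist w v + 1 :=
    fun v hv => hA.dist_of_adj_notMem hT hw hy hwy hv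
  by_cases hw1 : degIn T A w = 1
  · obtain ⟨x, hx, hx1, hxw, -⟩ := hA.exists_leaf_ne_ne hT hbr hw w
    obtain ⟨u, hu, hxu⟩ := exists_adj_of_degIn_pos (T := T) (A := A) (x := x) (by omega)
    have huw : u ≠ w := by
      rintro rfl
      exact hA.not_adj_of_leaf_of_leaf hT hbr hx hx1 hw hw1 hxu
    have huy : u ≠ y := by
      rintro rfl
      exact hy hu
    have hudeg : degIn T (A.erase x) u ≤ 1 := by
      rw [h.degIn_eq x hx hx1 hxw u hu hxu]
      exact (degIn_mono (Finset.erase_subset x A) w).trans hw1.le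
    have hAx := hA.erase_leaf hT.connected hx hx1
    have huA : u ∈ A.erase x := Finset.mem_erase.2 ⟨hxu.ne', hu⟩
    have hwA : w ∈ A.erase x := Finset.mem_erase.2 ⟨hxw.symm, hw⟩
    obtain ⟨c, hc, huc, -⟩ := hAx.exists_adj_mem hT.connected huA hwA huw
    refine ⟨x, hx, hx1, hxw, u, Finset.mem_insert_of_mem huA, ?_, huy, ?_⟩
    · refine degIn_eq_one (Finset.mem_insert_of_mem hc) huc fun d hd hud => ?_
      rcases Finset.mem_insert.1 hd with rfl | hd
      · exact absurd (hA.eq_of_adj_of_adj_notMem hT hw hy hwy hu hud.symm) huw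
      · exact eq_of_degIn_le_one hudeg hd hc hud huc
    · intro heq
      have e1 := distSum_swap (T := T) hx hy u
      have e2 := distSum_swap (T := T) hx hy y
      have e3 := h.distSum_eq x hx hx1 hxw
      have e4 := hA.distSum_of_leaf hT.connected hx hx1 hu hxu
      have e5 := hA.dist_of_leaf hT.connected hx hx1 hu hxu hw hxw.symm
      have e6 := hA.dist_add_two_le_card hT hbr hw hx
      rw [dist_eq_one_iff_adj.2 hxu.symm, dist_comm (v := y), hdy u hu] at e1
      rw [dist_self, hdy x hx] at e2
      rw [hdy u hu] at heq
      rw [dist_comm (u := x), dist_comm (u := u)] at e5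
      omega
  · obtain ⟨x', hx', hx'1, hx'w, -⟩ := hA.exists_leaf_ne_ne hT hbr hw w
    obtain ⟨x, hx, hx1, hxd⟩ := hA.exists_leaf_beyond hT hx' hw hx'w
    have hpos := hT.connected.pos_dist_of_ne hx'w
    have hxx' : x' ≠ x := by
      rintro rfl
      rw [dist_self] at hxd
      omega
    refine ⟨x, hx, hx1, fun e => hw1 (e ▸ hx1), x',
      Finset.mem_insert_of_mem (Finset.mem_erase.2 ⟨hxx', hx'⟩),
      hA.degIn_swap_eq_one hT hbr hw hy hwy hx hx1 hx' hx'1 hx'w,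
      fun e => hy (e ▸ hx'), fun heq => ?_⟩
    have e1 := distSum_swap (T := T) hx hy x'
    have e2 := distSum_swap (T := T) hx hy y
    have e3 := h.distSum_eq x' hx' hx'1 hx'w
    rw [dist_comm (v := y), hdy x' hx'] at e1
    rw [dist_self, hdy x hx] at e2
    rw [hdy x' hx'] at heq
    rw [dist_comm (u := x') (v := w)] at hxd
    omega

lemma SwapStable.dist_add_dist_eq (h : SwapStable T A w) (hA : GeodConvex T A) (hT : T.IsTree)
    (hw : w ∈ A) (hy : y ∉ A) (hwy : T.Adj w y) (hx : x ∈ A)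
    (hx' : x' ∈ A) (hx'1 : degIn T A x' = 1) (hx'w : x' ≠ w)
    (heq : distSum T (insert y (A.erase x)) x' + T.dist w x' + 1 =
        distSum T (insert y (A.erase x)) w + A.card) :
    T.dist w x' + T.dist w x = T.dist x' x := by
  have e1 := distSum_swap (T := T) hx hy x'
  have e2 := distSum_swap (T := T) hx hy w
  have e3 := h.distSum_eq x' hx' hx'1 hx'w
  rw [dist_comm (v := y), hA.dist_of_adj_notMem hT hw hy hwy hx'] at e1
  rw [dist_eq_one_iff_adj.2 hwy] at e2
  omega

/-- After moving a suitable leaf to a new neighbour `y` of `w`, some further leaf cannot be moved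
to another neighbour of `w` without changing the Wiener index. -/
lemma SwapStable.exists_swap_at_old (h : SwapStable T A w) (hA : GeodConvex T A) (hT : T.IsTree)
    (hbr : Branching T A) (hns : ∃ a ∈ A, ∃ b ∈ A, a ≠ b ∧ degIn T A a ≠ 1 ∧ degIn T A b ≠ 1)
    (hw : w ∈ A) (hy : y ∉ A) (hwy : T.Adj w y) :
    ∃ x ∈ A, degIn T A x = 1 ∧ x ≠ w ∧ ∃ x' ∈ insert y (A.erase x),
      degIn T (insert y (A.erase x)) x' = 1 ∧ x' ≠ w ∧
      distSum T (insert y (A.erase x)) x' + T.dist w x' + 1 ≠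
        distSum T (insert y (A.erase x)) w + A.card := by
  suffices ∃ x ∈ A, degIn T A x = 1 ∧ x ≠ w ∧ ∃ x' ∈ A, degIn T A x' = 1 ∧ x' ≠ w ∧ x' ≠ x ∧
      T.dist w x' + T.dist w x ≠ T.dist x' x by
    obtain ⟨x, hx, hx1, hxw, x', hx', hx'1, hx'w, hx'x, hne⟩ := this
    exact ⟨x, hx, hx1, hxw, x', Finset.mem_insert_of_mem (Finset.mem_erase.2 ⟨hx'x, hx'⟩),
      hA.degIn_swap_eq_one hT hbr hw hy hwy hx hx1 hx' hx'1 hx'w, hx'w,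
      fun heq => hne (h.dist_add_dist_eq hA hT hw hy hwy hx hx' hx'1 hx'w heq)⟩
  by_cases hw1 : degIn T A w = 1
  · obtain ⟨x, hx, hx1, hxw, -⟩ := hA.exists_leaf_ne_ne hT hbr hw w
    obtain ⟨x', hx', hx'1, hx'x, hx'w⟩ := hA.exists_leaf_ne_ne hT hbr hx w
    refine ⟨x, hx, hx1, hxw, x', hx', hx'1, hx'w, hx'x, ?_⟩
    have := hA.dist_lt_of_leaf hT.connected hw hw1 hx' hx hx'w hxw
    rw [dist_comm (u := x') (v := w)] at this
    omega
  · obtain ⟨c, hc, hcw, hc1⟩ : ∃ c ∈ A, c ≠ w ∧ degIn T A c ≠ 1 := by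
      obtain ⟨a, ha, b, hb, hab, ha1, hb1⟩ := hns
      by_cases haw : a = w
      · exact ⟨b, hb, fun e => hab (haw.trans e.symm), hb1⟩
      · exact ⟨a, ha, haw, ha1⟩
    obtain ⟨x, hx, hx1, hxd⟩ := hA.exists_leaf_beyond hT hw hc hcw.symm
    have hcx : c ≠ x := fun e => hc1 (e ▸ hx1)
    have hxw : x ≠ w := fun e => hw1 (e ▸ hx1)
    have p1 := hT.connected.pos_dist_of_ne hcx
    have p2 := hT.connected.pos_dist_of_ne hcw
    rw [dist_comm] at p2
    obtain ⟨u, hu, hxu⟩ := exists_adj_of_degIn_pos (T := T) (A := A) (x := x) (by omega)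
    have hud := hA.dist_of_leaf hT.connected hx hx1 hu hxu hw hxw.symm
    rw [dist_comm (u := x)] at hud
    have hnadj : ¬ T.Adj w x := by
      intro e
      rw [dist_eq_one_iff_adj.2 e] at hxd
      omega
    have hdeg := h.degIn_eq x hx hx1 hxw u hu hxu
    rw [degIn_erase_of_not_adj hnadj] at hdeg
    have hwpos := hA.degIn_pos hT.connected hw hc hcw.symm
    obtain ⟨z, hz, huz, hzd⟩ : ∃ z ∈ A.erase x, T.Adj u z ∧ T.dist u w + 1 = T.dist z w := by
      by_contra! hcon
      have : degIn T (A.erase x) u ≤ 1 := by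
        classical
        refine Finset.card_le_one.2 fun p hp q hq => ?_
        rw [Finset.mem_filter] at hp hq
        have hp' := (hT.dist_add_one_or hp.2 w).resolve_left (hcon p hp.1 hp.2)
        have hq' := (hT.dist_add_one_or hq.2 w).resolve_left (hcon q hq.1 hq.2)
        exact hT.eq_of_adj_of_dist_add_one hp.2 hq.2 hp' hq'
      omega
    have hzA := Finset.mem_of_mem_erase hz
    have hzw : z ≠ w := by
      rintro rfl
      rw [dist_self] at hzd
      omega
    obtain ⟨x', hx', hx'1, hx'd⟩ := hA.exists_leaf_beyond hT hw hzA hzw.symm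
    have hzx : z ≠ x := Finset.ne_of_mem_erase hz
    have t1 := hT.connected.dist_triangle (u := z) (v := u) (w := x)
    have t2 := hT.connected.dist_triangle (u := x') (v := z) (w := x)
    rw [dist_comm (u := z) (v := u), dist_eq_one_iff_adj.2 huz, dist_eq_one_iff_adj.2 hxu.symm] at t1
    rw [dist_comm (u := z) (v := w)] at hzd
    rw [dist_comm (u := x') (v := z)] at t2
    rw [dist_comm (u := u) (v := w)] at hzd hud
    have p3 := hT.connected.pos_dist_of_ne hxw
    have p4 := hT.connected.pos_dist_of_ne hzw
    refine ⟨x, hx, hx1, hxw, x', hx', hx'1, fun e => hw1 (e ▸ hx'1), ?_, by omega⟩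
    rintro rfl
    have := hT.connected.pos_dist_of_ne hzx
    omega

end SimpleGraph

section WeightedAveraging

variable {V : Type*} [DecidableEq V] {K N : Finset (Finset V)} {A A' B : Finset V} {k : ℕ}

/-- The members of the family `K` containing `B`. -/
def extensions (K : Finset (Finset V)) (B : Finset V) : Finset (Finset V) :=
  K.filter (B ⊆ ·)

/-- The total weight of the moves from `A` to `A'` which remove one element and then add one
element, chosen uniformly so as to stay in the family `K` of `k`-sets. -/
noncomputable def moveWeight (K : Finset (Finset V)) (k : ℕ) (A A' : Finset V) : ℝ :=
  ∑ B ∈ (A ∩ A').powersetCard (k - 1), ((extensions K B).card : ℝ)⁻¹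

lemma moveWeight_nonneg : 0 ≤ moveWeight K k A A' :=
  Finset.sum_nonneg fun _ _ => by positivity

lemma moveWeight_comm : moveWeight K k A A' = moveWeight K k A' A := by
  rw [moveWeight, Finset.inter_comm, moveWeight]

lemma sum_moveWeight_le (hA : A.card = k) (hk : 1 ≤ k) :
    ∑ A' ∈ K, moveWeight K k A A' ≤ k := by
  have h1 : ∀ A' ∈ K, moveWeight K k A A' = ∑ B ∈ A.powersetCard (k - 1),
      if B ⊆ A' then ((extensions K B).card : ℝ)⁻¹ else 0 := by
    intro A' _
    rw [moveWeight, ← Finset.sum_filter]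
    congr 1
    ext B
    simp only [Finset.mem_powersetCard, Finset.mem_filter, Finset.subset_inter_iff]
    tauto
  rw [Finset.sum_congr rfl h1, Finset.sum_comm]
  calc ∑ B ∈ A.powersetCard (k - 1), ∑ A' ∈ K,
        (if B ⊆ A' then ((extensions K B).card : ℝ)⁻¹ else 0)
      ≤ ∑ B ∈ A.powersetCard (k - 1), 1 := by
        refine Finset.sum_le_sum fun B _ => ?_
        rw [← Finset.sum_filter, Finset.sum_const, nsmul_eq_mul]
        exact mul_inv_le_one
    _ = k := by
        rw [Finset.sum_const, Finset.card_powersetCard, hA, nsmul_eq_mul, mul_one,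
          Nat.choose_symm_of_eq_add (show k = (k - 1) + 1 by omega), Nat.choose_one_right]

lemma inv_le_moveWeight {M : ℝ} (hA : A ∈ K) (hBA : B ⊆ A) (hBA' : B ⊆ A') (hB : B.card = k - 1)
    (hM : ((extensions K B).card : ℝ) ≤ M) : M⁻¹ ≤ moveWeight K k A A' := by
  have hpos : 0 < (extensions K B).card :=
    Finset.card_pos.2 ⟨A, Finset.mem_filter.2 ⟨hA, hBA⟩⟩
  refine (inv_anti₀ (by exact_mod_cast hpos) hM).trans ?_
  exact Finset.single_le_sum (f := fun B => ((extensions K B).card : ℝ)⁻¹)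
    (fun _ _ => by positivity)
    (Finset.mem_powersetCard.2 ⟨Finset.subset_inter hBA hBA', hB⟩)

/-- Moves from `A` which insert distinct new elements `y` contribute additively. -/
lemma card_mul_le_sum_moveWeight {M c : ℝ} {F : Finset V → ℝ} {L : Finset (Finset V)}
    {Y : Finset V} {x : V → V} (hAK : A ∈ K) (hA : A.card = k) (hF : ∀ A' ∈ L, 0 ≤ F A')
    (hc : 0 ≤ c) (hY : ∀ y ∈ Y, y ∉ A) (hx : ∀ y ∈ Y, x y ∈ A)
    (hL : ∀ y ∈ Y, insert y (A.erase (x y)) ∈ L)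
    (hFc : ∀ y ∈ Y, c ≤ F (insert y (A.erase (x y))))
    (hM : ∀ y ∈ Y, ((extensions K (A.erase (x y))).card : ℝ) ≤ M) :
    Y.card * (M⁻¹ * c) ≤ ∑ A' ∈ L, moveWeight K k A A' * F A' := by
  have hinj : Set.InjOn (fun y => insert y (A.erase (x y))) Y := by
    intro y hy z hz hyz
    have hmem : y ∈ insert z (A.erase (x z)) := by
      rw [← show insert y (A.erase (x y)) = insert z (A.erase (x z)) from hyz]
      exact Finset.mem_insert_self _ _
    rcases Finset.mem_insert.1 hmem with h | h
    · exact h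
    · exact absurd (Finset.mem_of_mem_erase h) (hY y hy)
  calc Y.card * (M⁻¹ * c) = ∑ _y ∈ Y, M⁻¹ * c := by rw [Finset.sum_const, nsmul_eq_mul]
    _ ≤ ∑ y ∈ Y, moveWeight K k A (insert y (A.erase (x y))) *
          F (insert y (A.erase (x y))) := by
        refine Finset.sum_le_sum fun y hy => mul_le_mul ?_ (hFc y hy) hc moveWeight_nonneg
        exact inv_le_moveWeight hAK (Finset.erase_subset _ _) (Finset.subset_insert _ _)
          (by rw [Finset.card_erase_of_mem (hx y hy), hA]) (hM y hy)
    _ = ∑ A' ∈ Y.image fun y => insert y (A.erase (x y)), moveWeight K k A A' * F A' :=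
        (Finset.sum_image (f := fun A' => moveWeight K k A A' * F A') hinj).symm
    _ ≤ ∑ A' ∈ L, moveWeight K k A A' * F A' :=
        Finset.sum_le_sum_of_subset_of_nonneg (Finset.image_subset_iff.2 hL)
          fun A' hA' _ => mul_nonneg moveWeight_nonneg (hF A' hA')

/-- The total weight of the moves from `A` into `N`. -/
noncomputable def weightInto (K N : Finset (Finset V)) (k : ℕ) (A : Finset V) : ℝ :=
  ∑ A' ∈ N, moveWeight K k A A'

lemma weightInto_nonneg : 0 ≤ weightInto K N k A :=
  Finset.sum_nonneg fun _ _ => moveWeight_nonneg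

lemma sum_weightInto_le (hK : ∀ A ∈ K, A.card = k) (hk : 1 ≤ k) (hN : N ⊆ K) :
    ∑ A ∈ K, weightInto K N k A ≤ k * N.card := by
  unfold weightInto
  rw [Finset.sum_comm]
  calc ∑ A' ∈ N, ∑ A ∈ K, moveWeight K k A A' ≤ ∑ _A' ∈ N, (k : ℝ) := by
        refine Finset.sum_le_sum fun A' hA' => ?_
        rw [Finset.sum_congr rfl fun A _ => moveWeight_comm]
        exact sum_moveWeight_le (hK A' (hN hA')) hk
    _ = k * N.card := by rw [Finset.sum_const, nsmul_eq_mul, mul_comm]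

lemma sum_moveWeight_mul_weightInto_le (hK : ∀ A ∈ K, A.card = k) (hk : 1 ≤ k) (hN : N ⊆ K) :
    ∑ A ∈ K, ∑ A' ∈ K, moveWeight K k A A' * weightInto K N k A' ≤ k * (k * N.card) := by
  rw [Finset.sum_comm]
  calc ∑ A' ∈ K, ∑ A ∈ K, moveWeight K k A A' * weightInto K N k A'
      ≤ ∑ A' ∈ K, k * weightInto K N k A' := by
        refine Finset.sum_le_sum fun A' hA' => ?_
        rw [← Finset.sum_mul, Finset.sum_congr rfl fun A _ => moveWeight_comm]
        exact mul_le_mul_of_nonneg_right (sum_moveWeight_le (hK A' hA') hk) weightInto_nonneg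
    _ ≤ k * (k * N.card) := by
        rw [← Finset.mul_sum]
        exact mul_le_mul_of_nonneg_left (sum_weightInto_le hK hk hN) (by positivity)

/-- If every member of `K` outside `N` reaches `N` in at most two moves with weight at least `c`,
then `N` is a positive proportion of `K`. -/
lemma card_sdiff_le_of_weightInto {c : ℝ} (hK : ∀ A ∈ K, A.card = k) (hk : 1 ≤ k) (hN : N ⊆ K)
    (hc : ∀ A ∈ K \ N, c ≤ weightInto K N k A +
      ∑ A' ∈ K, moveWeight K k A A' * weightInto K N k A') :
    (K \ N).card * c ≤ (k + k * k) * N.card := by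
  have hnn : ∀ A, 0 ≤ weightInto K N k A +
      ∑ A' ∈ K, moveWeight K k A A' * weightInto K N k A' := fun A =>
    add_nonneg weightInto_nonneg
      (Finset.sum_nonneg fun _ _ => mul_nonneg moveWeight_nonneg weightInto_nonneg)
  calc (K \ N).card * c = ∑ _A ∈ K \ N, c := by rw [Finset.sum_const, nsmul_eq_mul]
    _ ≤ ∑ A ∈ K \ N, (weightInto K N k A +
          ∑ A' ∈ K, moveWeight K k A A' * weightInto K N k A') := Finset.sum_le_sum hc
    _ ≤ ∑ A ∈ K, (weightInto K N k A +
          ∑ A' ∈ K, moveWeight K k A A' * weightInto K N k A') :=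
        Finset.sum_le_sum_of_subset_of_nonneg Finset.sdiff_subset fun A _ _ => hnn A
    _ ≤ k * N.card + k * (k * N.card) := by
        rw [Finset.sum_add_distrib]
        exact add_le_add (sum_weightInto_le hK hk hN) (sum_moveWeight_mul_weightInto_le hK hk hN)
    _ = (k + k * k) * N.card := by ring

end WeightedAveraging

namespace SimpleGraph

open Classical in
/-- The vertex sets of the `k`-vertex subtrees of `T`. -/
noncomputable def subtrees {V : Type*} [Fintype V] (T : SimpleGraph V) (k : ℕ) :
    Finset (Finset V) :=
  Finset.univ.filter fun A => A.card = k ∧ (T.induce (A : Set V)).Connected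

open Classical in
/-- The neighbours of `v` outside `A`. -/
noncomputable def outerNbrs {V : Type*} [Fintype V] (T : SimpleGraph V) (A : Finset V) (v : V) :
    Finset V :=
  Finset.univ.filter fun y => T.Adj v y ∧ y ∉ A

variable {V : Type*} [Fintype V] {T : SimpleGraph V} {A B : Finset V} {u v w x y z : V} {k : ℕ}

lemma mem_outerNbrs : y ∈ outerNbrs T A v ↔ T.Adj v y ∧ y ∉ A := by
  simp [outerNbrs]

lemma mem_subtrees : A ∈ subtrees T k ↔ A.card = k ∧ (T.induce (A : Set V)).Connected := by
  simp [subtrees]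

lemma IsTree.geodConvex_of_mem_subtrees (hT : T.IsTree) (hA : A ∈ subtrees T k) :
    GeodConvex T A :=
  hT.geodConvex_of_induce_connected (mem_subtrees.1 hA).2

lemma Connected.exists_outerNbrs_nonempty (hT : T.Connected) (hA : A.Nonempty) (hz : z ∉ A) :
    ∃ w ∈ A, (outerNbrs T A w).Nonempty := by
  obtain ⟨w, hw, hmin⟩ := A.exists_min_image (fun a => T.dist a z) hA
  obtain ⟨c, hwc, hc⟩ := hT.exists_adj_dist_add_one (v := z) (fun e => hz (e ▸ hw))
  refine ⟨w, hw, c, mem_outerNbrs.2 ⟨hwc, fun hcA => ?_⟩⟩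
  have := hmin c hcA
  omega

variable [DecidableEq V]

lemma GeodConvex.swap_mem_subtrees (hA : GeodConvex T A) (hT : T.IsTree) (hx : x ∈ A)
    (hx1 : degIn T A x = 1) (hw : w ∈ A) (hwx : w ≠ x) (hy : y ∉ A) (hwy : T.Adj w y) :
    insert y (A.erase x) ∈ subtrees T A.card := by
  refine mem_subtrees.2 ⟨card_swap hx hy, ?_⟩
  exact ((hA.erase_leaf hT.connected hx hx1).insert_adj hT
    (Finset.mem_erase.2 ⟨hwx, hw⟩) hwy).induce_connected hT.connected (Finset.insert_nonempty _ _)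

lemma IsTree.card_extensions_le (hT : T.IsTree) (hB : B.Nonempty) :
    (extensions (subtrees T (B.card + 1)) B).card ≤ ∑ v ∈ B, (outerNbrs T B v).card := by
  have h : extensions (subtrees T (B.card + 1)) B ⊆
      (B.biUnion (outerNbrs T B)).image fun y => insert y B := by
    intro A hA
    obtain ⟨hA, hBA⟩ := Finset.mem_filter.1 hA
    obtain ⟨y, hyB, rfl⟩ := Finset.exists_eq_insert_iff.2 ⟨hBA, (mem_subtrees.1 hA).1.symm⟩
    obtain ⟨b, hb⟩ := hB
    obtain ⟨c, hc, hyc, -⟩ := (hT.geodConvex_of_mem_subtrees hA).exists_adj_mem hT.connected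
      (Finset.mem_insert_self y B) (Finset.mem_insert_of_mem hb) (fun e => hyB (e ▸ hb))
    have hcB := (Finset.mem_insert.1 hc).resolve_left hyc.ne'
    exact Finset.mem_image.2
      ⟨y, Finset.mem_biUnion.2 ⟨c, hcB, mem_outerNbrs.2 ⟨hyc.symm, hyB⟩⟩, rfl⟩
  exact (Finset.card_le_card h).trans (Finset.card_image_le.trans Finset.card_biUnion_le)

lemma card_outerNbrs_erase_le (x v : V) :
    (outerNbrs T (A.erase x) v).card ≤ (outerNbrs T A v).card + 1 := by
  refine (Finset.card_le_card (t := insert x (outerNbrs T A v)) fun z hz => ?_).trans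
    (Finset.card_insert_le _ _)
  obtain ⟨h1, h2⟩ := mem_outerNbrs.1 hz
  rw [Finset.mem_insert, mem_outerNbrs]
  by_cases hzx : z = x
  · exact Or.inl hzx
  · exact Or.inr ⟨h1, fun h => h2 (Finset.mem_erase.2 ⟨hzx, h⟩)⟩

lemma card_outerNbrs_insert_le (y v : V) :
    (outerNbrs T (insert y A) v).card ≤ (outerNbrs T A v).card := by
  refine Finset.card_le_card fun z hz => ?_
  obtain ⟨h1, h2⟩ := mem_outerNbrs.1 hz
  exact mem_outerNbrs.2 ⟨h1, fun h => h2 (Finset.mem_insert_of_mem h)⟩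

/-- The number of extensions of `A.erase x` is controlled by the outer degrees in `A`. -/
lemma IsTree.card_extensions_erase_le (hT : T.IsTree) (hk : 2 ≤ A.card) (hx : x ∈ A) {r : ℕ}
    (hr : ∀ v ∈ A, (outerNbrs T A v).card ≤ r) :
    (extensions (subtrees T A.card) (A.erase x)).card ≤ A.card * (r + 1) := by
  have hcard := Finset.card_erase_add_one hx
  have h := hT.card_extensions_le (B := A.erase x) (Finset.card_pos.1 (by omega))
  rw [hcard] at h
  refine h.trans ((Finset.sum_le_card_nsmul _ _ (r + 1) fun v hv => ?_).trans ?_)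
  · exact (card_outerNbrs_erase_le x v).trans
      (Nat.add_le_add_right (hr v (Finset.mem_of_mem_erase hv)) 1)
  · rw [smul_eq_mul]
    exact Nat.mul_le_mul_right _ (by omega)

/-- If replacing `x` by any member of `Y` leads to `N`, and `Y` is not small compared to the outer
degrees of `A`, then the weight of the moves from `A` into `N` is bounded below. -/
lemma le_weightInto {N : Finset (Finset V)} {Y : Finset V} {r c : ℕ}
    (hA : A ∈ subtrees T k) (hT : T.IsTree) (hk : 2 ≤ k)
    (hx : x ∈ A) (hY : ∀ y ∈ Y, y ∉ A) (hN : ∀ y ∈ Y, insert y (A.erase x) ∈ N)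
    (hr : ∀ v ∈ A, (outerNbrs T A v).card ≤ r) (hc : 0 < c) (hYc : r + 1 ≤ c * Y.card) :
    ((c * k : ℕ) : ℝ)⁻¹ ≤ weightInto (subtrees T k) N k A := by
  obtain ⟨hAk, -⟩ := mem_subtrees.1 hA
  have hYpos : 0 < Y.card := by
    rcases Nat.eq_zero_or_pos Y.card with h | h
    · rw [h] at hYc
      omega
    · exact h
  have hext : (extensions (subtrees T k) (A.erase x)).card ≤ k * (c * Y.card) := by
    rw [← hAk]
    exact (hT.card_extensions_erase_le (by omega) hx hr).trans (Nat.mul_le_mul_left _ hYc)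
  have h := card_mul_le_sum_moveWeight (F := fun _ => 1) (c := 1) (L := N) (Y := Y)
    (x := fun _ => x) hA hAk (fun _ _ => zero_le_one) zero_le_one hY (fun _ _ => hx) hN
    (fun _ _ => le_rfl) (M := ((k * (c * Y.card) : ℕ) : ℝ)) (fun _ _ => by exact_mod_cast hext)
  simp only [mul_one] at h
  refine le_trans (le_of_eq ?_) h
  have h1 : (Y.card : ℝ) ≠ 0 := by positivity
  have h2 : (c : ℝ) ≠ 0 := by positivity
  have h3 : (k : ℝ) ≠ 0 := by positivity
  push_cast
  field_simp

end SimpleGraph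

namespace SimpleGraph

variable {V : Type*} [Fintype V] [DecidableEq V] {T : SimpleGraph V} {A B : Finset V}
  {N : Finset (Finset V)} {w x y : V} {k r : ℕ}

lemma IsTree.swap_mem_of_pairSum_id_ne {p : ℕ} (hT : T.IsTree)
    (hN : ∀ A' ∈ subtrees T k, A' ∉ N → pairSum T id A' = p) (hB : B ∈ subtrees T k)
    (hBp : pairSum T id B = p) (hx : x ∈ B) (hx1 : degIn T B x = 1) (hw : w ∈ B) (hxw : x ≠ w)
    (hne : distSum T B x + T.dist w x + 1 ≠ distSum T B w + B.card) :
    ∀ y ∈ outerNbrs T B w, insert y (B.erase x) ∈ N := by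
  intro y hy
  obtain ⟨hwy, hyB⟩ := mem_outerNbrs.1 hy
  have hBc := hT.geodConvex_of_mem_subtrees hB
  by_contra hcon
  have hmem := hBc.swap_mem_subtrees hT hx hx1 hw hxw.symm hyB hwy
  rw [(mem_subtrees.1 hB).1] at hmem
  exact hne ((hBc.pairSum_id_swap_eq_iff hT hx hw hyB hwy).1
    ((hN _ hmem hcon).trans hBp.symm))

lemma IsTree.swapStable_of_forall_exists (hT : T.IsTree)
    (hN : ∀ A' ∈ subtrees T k, A' ∉ N → ∀ f, pairSum T f A' = pairSum T f A)
    (hA : A ∈ subtrees T k) (hw : w ∈ A)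
    (h : ∀ x ∈ A, degIn T A x = 1 → x ≠ w → ∃ y ∈ outerNbrs T A w, insert y (A.erase x) ∉ N) :
    SwapStable T A w := by
  have hAc := hT.geodConvex_of_mem_subtrees hA
  have key : ∀ x ∈ A, degIn T A x = 1 → x ≠ w → ∃ y, T.Adj w y ∧ y ∉ A ∧
      ∀ f, pairSum T f (insert y (A.erase x)) = pairSum T f A := by
    intro x hx hx1 hxw
    obtain ⟨y, hy, hyN⟩ := h x hx hx1 hxw
    obtain ⟨hwy, hyA⟩ := mem_outerNbrs.1 hy
    have hmem := hAc.swap_mem_subtrees hT hx hx1 hw hxw.symm hyA hwy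
    rw [(mem_subtrees.1 hA).1] at hmem
    exact ⟨y, hwy, hyA, hN _ hmem hyN⟩
  refine ⟨fun x hx hx1 hxw => ?_, fun x hx hx1 hxw u hu hxu => ?_⟩
  all_goals obtain ⟨y, hwy, hyA, hf⟩ := key x hx hx1 hxw
  · exact (hAc.pairSum_id_swap_eq_iff hT hx hw hyA hwy).1 (hf id)
  · exact hAc.degIn_eq_of_pairSum_swap_eq hT hx hx1 hu hxu hw hyA hwy (hf _)

lemma SwapStable.le_weightInto_swap (h : SwapStable T A w) (hT : T.IsTree) (hk : 4 ≤ k)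
    (hN : ∀ A' ∈ subtrees T k, A' ∉ N → pairSum T id A' = pairSum T id A)
    (hA : A ∈ subtrees T k) (hbr : Branching T A)
    (hns : ∃ a ∈ A, ∃ b ∈ A, a ≠ b ∧ degIn T A a ≠ 1 ∧ degIn T A b ≠ 1) (hw : w ∈ A)
    (hr : ∀ v ∈ A, (outerNbrs T A v).card ≤ r) (hwr : (outerNbrs T A w).card = r)
    (hy : y ∈ outerNbrs T A w) (hpos : 2 ≤ r ∨ (outerNbrs T A y).Nonempty) :
    ∃ x ∈ A, degIn T A x = 1 ∧ x ≠ w ∧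
      ((4 * k : ℕ) : ℝ)⁻¹ ≤ weightInto (subtrees T k) N k (insert y (A.erase x)) := by
  have hAc := hT.geodConvex_of_mem_subtrees hA
  have hAk := (mem_subtrees.1 hA).1
  obtain ⟨hwy, hyA⟩ := mem_outerNbrs.1 hy
  have hswap : ∀ x ∈ A, degIn T A x = 1 → x ≠ w → insert y (A.erase x) ∈ subtrees T k ∧
      pairSum T id (insert y (A.erase x)) = pairSum T id A := by
    intro x hx hx1 hxw
    refine ⟨hAk ▸ hAc.swap_mem_subtrees hT hx hx1 hw hxw.symm hyA hwy, ?_⟩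
    exact (hAc.pairSum_id_swap_eq_iff hT hx hw hyA hwy).2 (h.distSum_eq x hx hx1 hxw)
  have hout : ∀ x, ∀ v ∈ insert y (A.erase x), (outerNbrs T (insert y (A.erase x)) v).card ≤
      max r (outerNbrs T A y).card + 1 := by
    intro x v hv
    have h1 := card_outerNbrs_insert_le (T := T) (A := A.erase x) y v
    have h2 := card_outerNbrs_erase_le (T := T) (A := A) x v
    have h3 : (outerNbrs T A v).card ≤ max r (outerNbrs T A y).card := by
      rcases Finset.mem_insert.1 hv with rfl | hv
      · exact le_max_right _ _
      · exact (hr v (Finset.mem_of_mem_erase hv)).trans (le_max_left _ _)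
    omega
  by_cases hcase : r ≤ (outerNbrs T A y).card + 1 ∧ (outerNbrs T A y).Nonempty
  · obtain ⟨x, hx, hx1, hxw, x', hx', hx'1, hx'y, hne⟩ :=
      h.exists_swap_at_new hAc hT hbr (hk.trans_eq hAk.symm) hw hyA hwy
    obtain ⟨hmem, hp⟩ := hswap x hx hx1 hxw
    rw [← card_swap hx hyA] at hne
    have hsecond := hT.swap_mem_of_pairSum_id_ne hN hmem hp hx' hx'1
      (Finset.mem_insert_self _ _) hx'y hne
    have hY : ∀ z ∈ outerNbrs T A y, z ∉ insert y (A.erase x) := by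
      intro z hz hzmem
      obtain ⟨hyz, hzA⟩ := mem_outerNbrs.1 hz
      rcases Finset.mem_insert.1 hzmem with rfl | hzmem
      · exact hyz.ne rfl
      · exact hzA (Finset.mem_of_mem_erase hzmem)
    refine ⟨x, hx, hx1, hxw, le_weightInto hmem hT (by omega) hx' hY (fun z hz => hsecond z
      (mem_outerNbrs.2 ⟨(mem_outerNbrs.1 hz).1, hY z hz⟩)) (hout x) (by norm_num) ?_⟩
    have := Finset.card_pos.2 hcase.2
    omega
  · obtain ⟨x, hx, hx1, hxw, x', hx', hx'1, hx'w, hne⟩ :=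
      h.exists_swap_at_old hAc hT hbr hns hw hyA hwy
    obtain ⟨hmem, hp⟩ := hswap x hx hx1 hxw
    rw [← card_swap hx hyA] at hne
    have hsecond := hT.swap_mem_of_pairSum_id_ne hN hmem hp hx' hx'1
      (Finset.mem_insert_of_mem (Finset.mem_erase.2 ⟨hxw.symm, hw⟩)) hx'w hne
    have hY : ∀ z ∈ (outerNbrs T A w).erase y, z ∉ insert y (A.erase x) := by
      intro z hz hzmem
      obtain ⟨hzy, hz⟩ := Finset.mem_erase.1 hz
      rcases Finset.mem_insert.1 hzmem with rfl | hzmem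
      · exact hzy rfl
      · exact (mem_outerNbrs.1 hz).2 (Finset.mem_of_mem_erase hzmem)
    refine ⟨x, hx, hx1, hxw, le_weightInto hmem hT (by omega) hx' hY (fun z hz => hsecond z
      (mem_outerNbrs.2 ⟨(mem_outerNbrs.1 (Finset.mem_of_mem_erase hz)).1, hY z hz⟩))
      (hout x) (by norm_num) ?_⟩
    have hcard := Finset.card_erase_add_one hy
    rw [← Finset.card_pos] at hpos hcase
    omega

/-- A subtree which is neither a path nor a star reaches `N` in at most two moves with weight
bounded below, provided `N` contains all subtrees with other distance distributions. -/
lemma IsTree.le_weightInto_add (hT : T.IsTree) (hk : 5 ≤ k) (hcard : k + 2 ≤ Fintype.card V)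
    (hN : ∀ A' ∈ subtrees T k, A' ∉ N → ∀ f, pairSum T f A' = pairSum T f A)
    (hA : A ∈ subtrees T k) (hbr : Branching T A)
    (hns : ∃ a ∈ A, ∃ b ∈ A, a ≠ b ∧ degIn T A a ≠ 1 ∧ degIn T A b ≠ 1) :
    ((8 * k * k : ℕ) : ℝ)⁻¹ ≤ weightInto (subtrees T k) N k A +
      ∑ A' ∈ subtrees T k, moveWeight (subtrees T k) k A A' *
        weightInto (subtrees T k) N k A' := by
  have hAc := hT.geodConvex_of_mem_subtrees hA
  have hAk := (mem_subtrees.1 hA).1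
  have hne : A.Nonempty := Finset.card_pos.1 (by omega)
  obtain ⟨w, hw, hmax⟩ := A.exists_max_image (fun v => (outerNbrs T A v).card) hne
  obtain ⟨r, hwr⟩ : ∃ r, (outerNbrs T A w).card = r := ⟨_, rfl⟩
  rw [hwr] at hmax
  have hrpos : 1 ≤ r := by
    obtain ⟨z, hz⟩ : ∃ z, z ∉ A := by
      by_contra! hall
      have := Finset.card_le_card (fun v _ => hall v : Finset.univ ⊆ A)
      rw [Finset.card_univ] at this
      omega
    obtain ⟨v, hv, hvne⟩ := hT.connected.exists_outerNbrs_nonempty hne hz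
    exact (Finset.card_pos.2 hvne).trans_le (hmax v hv)
  have hw1nn := weightInto_nonneg (K := subtrees T k) (N := N) (k := k) (A := A)
  have hw2nn : 0 ≤ ∑ A' ∈ subtrees T k, moveWeight (subtrees T k) k A A' *
      weightInto (subtrees T k) N k A' :=
    Finset.sum_nonneg fun _ _ => mul_nonneg moveWeight_nonneg weightInto_nonneg
  by_cases hcase : ∃ v ∈ A, (outerNbrs T A v).card = r ∧ ∃ x ∈ A,
      ∀ y ∈ outerNbrs T A v, insert y (A.erase x) ∈ N
  · obtain ⟨v, hv, hvr, x, hx, hxN⟩ := hcase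
    have h1 := le_weightInto hA hT (by omega) hx (fun y hy => (mem_outerNbrs.1 hy).2) hxN hmax
      (c := 2) (by norm_num) (by omega)
    have h2 : ((8 * k * k : ℕ) : ℝ)⁻¹ ≤ ((2 * k : ℕ) : ℝ)⁻¹ :=
      inv_anti₀ (by exact_mod_cast (by omega)) (by exact_mod_cast (by nlinarith))
    linarith
  · push Not at hcase
    have hstab : ∀ v ∈ A, (outerNbrs T A v).card = r → SwapStable T A v := fun v hv hvr =>
      hT.swapStable_of_forall_exists hN hA hv fun x hx _ _ => hcase v hv hvr x hx
    have hst := hstab w hw hwr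
    have hpos : ∀ y ∈ outerNbrs T A w, 2 ≤ r ∨ (outerNbrs T A y).Nonempty := by
      intro y hy
      by_contra! hcon
      obtain ⟨hr2, hy0⟩ := hcon
      obtain ⟨hwy, hyA⟩ := mem_outerNbrs.1 hy
      obtain ⟨z, hz⟩ : ∃ z, z ∉ insert y A := by
        by_contra! hall
        have h1 := Finset.card_le_card (fun v _ => hall v : Finset.univ ⊆ insert y A)
        have h2 := Finset.card_insert_le y A
        rw [Finset.card_univ] at h1
        omega
      obtain ⟨v, hv, c, hc⟩ :=
        hT.connected.exists_outerNbrs_nonempty (Finset.insert_nonempty y A) hz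
      obtain ⟨hvc, hcA⟩ := mem_outerNbrs.1 hc
      rw [Finset.mem_insert, not_or] at hcA
      have hcv : c ∈ outerNbrs T A v := mem_outerNbrs.2 ⟨hvc, hcA.2⟩
      rcases Finset.mem_insert.1 hv with rfl | hv
      · rw [hy0] at hcv
        exact Finset.notMem_empty _ hcv
      · have hv1 : (outerNbrs T A v).card = r :=
          le_antisymm (hmax v hv) (by have := Finset.card_pos.2 ⟨c, hcv⟩; omega)
        obtain rfl := (hstab v hv hv1).eq hst hAc hT hbr hv hw
        exact hcA.1 (Finset.card_le_one.1 (by omega) c hcv y hy)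
    have hex : ∀ y, ∃ x, y ∈ outerNbrs T A w → x ∈ A ∧ degIn T A x = 1 ∧ x ≠ w ∧
        ((4 * k : ℕ) : ℝ)⁻¹ ≤ weightInto (subtrees T k) N k (insert y (A.erase x)) := by
      intro y
      by_cases hy : y ∈ outerNbrs T A w
      · obtain ⟨x, hx⟩ := hst.le_weightInto_swap hT (by omega) (fun A' h1 h2 => hN A' h1 h2 id)
          hA hbr hns hw hmax hwr hy (hpos y hy)
        exact ⟨x, fun _ => hx⟩
      · exact ⟨y, fun h => absurd h hy⟩
    choose x hx using hex
    have hM : ∀ y ∈ outerNbrs T A w,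
        ((extensions (subtrees T k) (A.erase (x y))).card : ℝ) ≤ ((2 * k * r : ℕ) : ℝ) := by
      intro y hy
      have h1 := hT.card_extensions_erase_le (by omega) (hx y hy).1 hmax
      rw [hAk] at h1
      have h2 : k * (r + 1) ≤ 2 * k * r := by nlinarith
      exact_mod_cast h1.trans h2
    have h := card_mul_le_sum_moveWeight (Y := outerNbrs T A w) (L := subtrees T k) (x := x)
      (F := weightInto (subtrees T k) N k) hA hAk (fun _ _ => weightInto_nonneg)
      (c := ((4 * k : ℕ) : ℝ)⁻¹) (by positivity) (fun y hy => (mem_outerNbrs.1 hy).2)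
      (fun y hy => (hx y hy).1)
      (fun y hy => by
        obtain ⟨hwy, hyA⟩ := mem_outerNbrs.1 hy
        obtain ⟨hxA, hx1, hxw, -⟩ := hx y hy
        exact hAk ▸ hAc.swap_mem_subtrees hT hxA hx1 hw hxw.symm hyA hwy)
      (fun y hy => (hx y hy).2.2.2) hM
    rw [hwr] at h
    have h3 : ((8 * k * k : ℕ) : ℝ)⁻¹ =
        r * (((2 * k * r : ℕ) : ℝ)⁻¹ * ((4 * k : ℕ) : ℝ)⁻¹) := by
      have e1 : (r : ℝ) ≠ 0 := by positivity
      have e2 : (k : ℝ) ≠ 0 := by positivity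
      push_cast
      field_simp
      norm_num
    linarith

end SimpleGraph

namespace SimpleGraph

section Copies

variable {V W : Type*} {T : SimpleGraph V} {S : SimpleGraph W} {A : Finset V}

lemma ndeg_apply_iso (φ : T.induce (A : Set V) ≃g S) (v : (A : Set V)) :
    ndeg S (φ v) = degIn T A v := by
  classical
  have hinj : Function.Injective fun z => (φ.symm z : V) :=
    Subtype.val_injective.comp φ.symm.injective
  rw [ndeg, degIn, ← Set.ncard_image_of_injective _ hinj, ← Set.ncard_coe_finset]
  congr 1
  ext c
  simp only [Set.mem_image, mem_neighborSet, Finset.coe_filter, Set.mem_ofPred_eq]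
  constructor
  · rintro ⟨z, hz, rfl⟩
    refine ⟨(φ.symm z).2, ?_⟩
    have := φ.symm.map_adj_iff.2 hz
    rwa [φ.symm_apply_apply] at this
  · rintro ⟨hc, hvc⟩
    refine ⟨φ ⟨c, hc⟩, φ.map_adj_iff.2 hvc, ?_⟩
    rw [φ.symm_apply_apply]

lemma branching_of_not_isPathlike (hpath : ¬ IsPathlike S) (φ : T.induce (A : Set V) ≃g S) :
    Branching T A := by
  unfold IsPathlike at hpath
  push Not at hpath
  obtain ⟨z, hz⟩ := hpath
  refine ⟨φ.symm z, (φ.symm z).2, ?_⟩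
  rw [← ndeg_apply_iso φ, φ.apply_symm_apply]
  exact hz

lemma exists_degIn_ne_one_of_not_isStarlike (hstar : ¬ IsStarlike S)
    (φ : T.induce (A : Set V) ≃g S) :
    ∃ a ∈ A, ∃ b ∈ A, a ≠ b ∧ degIn T A a ≠ 1 ∧ degIn T A b ≠ 1 := by
  unfold IsStarlike at hstar
  rw [Set.not_subsingleton_iff] at hstar
  obtain ⟨a, ha, b, hb, hab⟩ := hstar
  refine ⟨φ.symm a, (φ.symm a).2, φ.symm b, (φ.symm b).2,
    fun e => hab (φ.symm.injective (Subtype.ext e)), ?_, ?_⟩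
  · rw [← ndeg_apply_iso φ, φ.apply_symm_apply]
    exact ha
  · rw [← ndeg_apply_iso φ, φ.apply_symm_apply]
    exact hb

end Copies

section Density

variable {V W : Type*} [Fintype V] {T : SimpleGraph V} {S : SimpleGraph W} {A : Finset V} {k : ℕ}

open Classical in
/-- The vertex sets of the subtrees of `T` isomorphic to the `k`-vertex tree `S`. -/
noncomputable def copies (T : SimpleGraph V) (S : SimpleGraph W) (k : ℕ) : Finset (Finset V) :=
  (subtrees T k).filter fun A => Nonempty (T.induce (A : Set V) ≃g S)

lemma mem_copies : A ∈ copies T S k ↔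
    A ∈ subtrees T k ∧ Nonempty (T.induce (A : Set V) ≃g S) := by
  simp [copies]

lemma subtreeCount_eq_card : subtreeCount T k = (subtrees T k).card := by
  rw [subtreeCount, ← Set.ncard_coe_finset]
  congr 1
  ext A
  simp [mem_subtrees]

lemma embCount_eq_card (hS : S.Connected) : embCount T S k = (copies T S k).card := by
  rw [embCount, ← Set.ncard_coe_finset]
  congr 1
  ext A
  simp only [Set.mem_ofPred_eq, Finset.mem_coe, mem_copies, mem_subtrees]
  exact ⟨fun h => ⟨⟨h.1, h.2.elim fun φ => φ.connected_iff.2 hS⟩, h.2⟩, fun h => ⟨h.1.1, h.2⟩⟩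

/-- A positive proportion of the `k`-vertex subtrees of a tree are not copies of `S`. -/
lemma IsTree.card_copies_le [DecidableEq V] (hT : T.IsTree) (hk : 5 ≤ k)
    (hcard : k + 2 ≤ Fintype.card V) (hstar : ¬ IsStarlike S) (hpath : ¬ IsPathlike S) :
    ((copies T S k).card : ℝ) ≤
      (8 * k * k) * (k + k * k) * (((subtrees T k).card : ℝ) - (copies T S k).card) := by
  have hsub : copies T S k ⊆ subtrees T k := fun A hA => (mem_copies.1 hA).1
  have h := card_sdiff_le_of_weightInto (K := subtrees T k) (N := subtrees T k \ copies T S k)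
    (c := ((8 * k * k : ℕ) : ℝ)⁻¹) (fun A hA => (mem_subtrees.1 hA).1) (by omega)
    Finset.sdiff_subset fun A hA => by
      rw [Finset.sdiff_sdiff_eq_self hsub] at hA
      obtain ⟨hA, ⟨φ⟩⟩ := mem_copies.1 hA
      refine hT.le_weightInto_add hk hcard (fun A' hA' hA'N f => ?_) hA
        (branching_of_not_isPathlike hpath φ) (exists_degIn_ne_one_of_not_isStarlike hstar φ)
      obtain ⟨-, ⟨φ'⟩⟩ := mem_copies.1
        (by_contra fun h => hA'N (Finset.mem_sdiff.2 ⟨hA', h⟩))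
      exact pairSum_eq_of_iso hT.connected (hT.geodConvex_of_mem_subtrees hA')
        (hT.geodConvex_of_mem_subtrees hA) (φ'.trans φ.symm) f
  rw [Finset.sdiff_sdiff_eq_self hsub, Finset.cast_card_sdiff hsub] at h
  have hkpos : (0 : ℝ) < ((8 * k * k : ℕ) : ℝ) := by positivity
  rw [← div_eq_mul_inv, div_le_iff₀ hkpos] at h
  push_cast at h
  linarith

lemma IsTree.density_le [Fintype W] (hT : T.IsTree) (hk : 5 ≤ k) (hWk : Fintype.card W = k)
    (hcard : k + 2 ≤ Fintype.card V) (hS : S.IsTree) (hstar : ¬ IsStarlike S)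
    (hpath : ¬ IsPathlike S) : density S T ≤ 1 - ((k : ℝ) ^ (2 * k - 3))⁻¹ := by
  classical
  rw [density, hWk, subtreeCount_eq_card, embCount_eq_card hS.connected]
  have h := hT.card_copies_le hk hcard hstar hpath
  have hk5 : (5 : ℝ) ≤ k := by exact_mod_cast hk
  have hD : (8 * k * k) * (k + k * k) + 1 ≤ (k : ℝ) ^ (2 * k - 3) := by
    have h7 : (k : ℝ) ^ 7 ≤ (k : ℝ) ^ (2 * k - 3) :=
      pow_le_pow_right₀ (by linarith) (by omega)
    have h3 : (125 : ℝ) ≤ (k : ℝ) ^ 3 := by nlinarith [pow_le_pow_left₀ (by norm_num) hk5 3]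
    nlinarith [pow_pos (by linarith : (0 : ℝ) < k) 4,
      pow_le_pow_left₀ (by norm_num) hk5 4,
      mul_le_mul_of_nonneg_right h3 (by positivity : (0 : ℝ) ≤ (k : ℝ) ^ 4),
      mul_le_mul_of_nonneg_right hk5 (by positivity : (0 : ℝ) ≤ (k : ℝ) ^ 3)]
  set D : ℝ := (8 * k * k) * (k + k * k) with hDdef
  have hDpos : 0 ≤ D := by positivity
  refine le_trans ?_ (sub_le_sub_left (inv_anti₀ (by linarith) hD) 1)
  rcases Nat.eq_zero_or_pos (subtrees T k).card with h0 | h0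
  · rw [h0, Nat.cast_zero, div_zero, sub_nonneg]
    exact inv_le_one_of_one_le₀ (by linarith)
  · have hpos : (0 : ℝ) < (subtrees T k).card := by exact_mod_cast h0
    rw [div_le_iff₀ hpos, show 1 - (D + 1)⁻¹ = D / (D + 1) by field_simp; ring, div_mul_eq_mul_div,
      le_div_iff₀ (by linarith)]
    linarith

end Density

lemma density_nonneg {V W : Type*} [Fintype V] [Fintype W] (S : SimpleGraph W)
    (T : SimpleGraph V) : 0 ≤ density S T := by
  unfold density
  positivity

lemma maxDensity_nonneg {W : Type*} [Fintype W] (S : SimpleGraph W) (n : ℕ) :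
    0 ≤ maxDensity S n := by
  refine Real.sSup_nonneg ?_
  rintro _ ⟨T, -, rfl⟩
  exact density_nonneg S T

lemma maxDensity_le {W : Type*} [Fintype W] {S : SimpleGraph W} {k n : ℕ} (hk : 5 ≤ k)
    (hWk : Fintype.card W = k) (hn : k + 2 ≤ n) (hS : S.IsTree) (hstar : ¬ IsStarlike S)
    (hpath : ¬ IsPathlike S) : maxDensity S n ≤ 1 - ((k : ℝ) ^ (2 * k - 3))⁻¹ := by
  refine Real.sSup_le ?_ ?_
  · rintro _ ⟨T, hT, rfl⟩
    exact hT.density_le hk hWk (by rwa [Fintype.card_fin]) hS hstar hpath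
  · rw [sub_nonneg]
    exact inv_le_one_of_one_le₀ (one_le_pow₀ (by exact_mod_cast (by omega : 1 ≤ k)))

end SimpleGraph

/-- For every k ≥ 5, the inducibility of every k-vertex tree S that is
neither a path nor a star is at most 1 - k^(-(2k-3)). -/
theorem inducibility_le_small_trees {W : Type*} [Fintype W]
    (k : ℕ) (hk : 5 ≤ k)
    (S : SimpleGraph W) (hS : S.IsTree) (hcard : Fintype.card W = k)
    (hstar : ¬ IsStarlike S) (hpath : ¬ IsPathlike S) :
    inducibility S ≤ 1 - ((k : ℝ) ^ (2 * k - 3))⁻¹ := by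
  refine limsup_le_of_le ?_ ?_
  · exact IsCoboundedUnder.of_frequently_ge (a := 0)
      (Frequently.of_forall fun n => maxDensity_nonneg S n)
  · filter_upwards [eventually_ge_atTop (k + 2)] with n hn
    exact maxDensity_le hk hcard hn hS hstar hpath
end

section
/- For every k ≥ 5, every k-vertex tree S that is neither a path nor a star, and every tree T with at least k^k vertices, d(S,T) ≤ 1 - k^{-(2k-3)}. -/
open SimpleGraph Filter

section Growth

variable {V : Type*} {G : SimpleGraph V}

/-- A vertex set that meets a connected set without containing it has a boundary edge inside the
connected set. -/
theorem exists_adj_boundary {s : Set V} (hs : (G.induce s).Connected) {t : Set V} {a b : V}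
    (ha : a ∈ s) (hat : a ∈ t) (hb : b ∈ s) (hbt : b ∉ t) :
    ∃ u ∈ t, u ∈ s ∧ ∃ w ∈ s, w ∉ t ∧ G.Adj u w := by
  obtain ⟨p⟩ := hs.preconnected ⟨a, ha⟩ ⟨b, hb⟩
  obtain ⟨d, -, h1, h2⟩ := p.exists_boundary_dart (Subtype.val ⁻¹' t) hat hbt
  exact ⟨d.fst, h1, d.fst.2, d.snd, d.snd.2, h2, d.adj⟩

theorem connected_induce_singleton (v : V) :
    (G.induce (({v} : Finset V) : Set V)).Connected := by
  rw [Finset.coe_singleton, induce_singleton_eq_top]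
  exact connected_top

section DecidableEq

variable [DecidableEq V]

theorem connected_induce_insert {t : Finset V} (ht : (G.induce (t : Set V)).Connected) {u w : V}
    (hu : u ∈ t) (huw : G.Adj u w) : (G.induce ((insert w t : Finset V) : Set V)).Connected := by
  have := connected_induce_union (t := {w}) ht.preconnected
    (by simp) hu rfl huw
  rwa [Finset.coe_insert, ← Set.union_singleton]

/-- Connected sets can be interpolated at every intermediate cardinality. -/
theorem exists_connected_between {A B : Finset V} (hA : (G.induce (A : Set V)).Connected)
    (hB : (G.induce (B : Set V)).Connected) (hAB : A ⊆ B) {m : ℕ} (hm : A.card ≤ m)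
    (hmB : m ≤ B.card) :
    ∃ C, A ⊆ C ∧ C ⊆ B ∧ C.card = m ∧ (G.induce (C : Set V)).Connected := by
  induction m, hm using Nat.le_induction with
  | base => exact ⟨A, subset_rfl, hAB, rfl, hA⟩
  | succ m _ ih =>
    obtain ⟨C, hAC, hCB, rfl, hC⟩ := ih (by omega)
    obtain ⟨⟨a, ha⟩⟩ := hC.nonempty
    obtain ⟨b, hb, hbC⟩ := Finset.exists_mem_notMem_of_card_lt_card (show C.card < B.card by omega)
    obtain ⟨u, hu, -, w, hw, hwC, huw⟩ := exists_adj_boundary hB (t := C) (hCB ha) ha hb hbC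
    exact ⟨insert w C, hAC.trans (Finset.subset_insert _ _), Finset.insert_subset hw hCB,
      Finset.card_insert_of_notMem hwC, connected_induce_insert hC hu huw⟩

/-- Adjoining neighbours of a vertex of a connected set keeps it connected. -/
theorem connected_induce_union_neighbors {A : Finset V} (hA : (G.induce (A : Set V)).Connected)
    {u : V} (hu : u ∈ A) (t : Finset V) (ht : ∀ w ∈ t, G.Adj u w) :
    (G.induce ((A ∪ t : Finset V) : Set V)).Connected := by
  induction t using Finset.induction_on with
  | empty => rwa [Finset.union_empty]
  | insert w t _ ih =>
    rw [Finset.union_insert]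
    exact connected_induce_insert (ih fun x hx => ht x (Finset.mem_insert_of_mem hx))
      (Finset.mem_union_left _ hu) (ht w (Finset.mem_insert_self _ _))

end DecidableEq

theorem ndeg_induce [DecidableRel G.Adj] (s : Finset V) (x : (s : Set V)) :
    ndeg (G.induce (s : Set V)) x = (s.filter (G.Adj x)).card := by
  rw [ndeg, ← Set.ncard_coe_finset, ← Set.ncard_image_of_injective _ Subtype.val_injective]
  congr 1
  ext y
  simp [and_comm]

theorem ndeg_iso {W : Type*} {H : SimpleGraph W} (e : G ≃g H) (x : V) :
    ndeg H (e x) = ndeg G x := by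
  rw [ndeg, ndeg, ← Set.ncard_image_of_injective _ e.injective]
  congr 1
  ext y
  obtain ⟨y, rfl⟩ := e.surjective y
  simp [e.map_adj_iff]

variable [DecidableEq V] [Fintype V] [DecidableRel G.Adj]

theorem exists_growth_family (v : V) (d j : ℕ) :
    ∃ F : Finset (Finset V), F.card ≤ j.factorial * d ^ j ∧ (∀ t ∈ F, v ∈ t ∧ t.card = j + 1) ∧
      ∀ s : Finset V, (G.induce (s : Set V)).Connected → v ∈ s → (∀ u ∈ s, G.degree u ≤ d) →
        j + 1 ≤ s.card → ∃ t ∈ F, t ⊆ s := by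
  induction j with
  | zero => exact ⟨{{v}}, by simp, by simp, fun s _ hv _ _ => ⟨{v}, by simp, by simpa⟩⟩
  | succ j ih =>
    obtain ⟨F, hF, hcard, hs⟩ := ih
    refine ⟨F.biUnion fun t => (t.filter (G.degree · ≤ d)).biUnion fun u =>
      (G.neighborFinset u \ t).image (insert · t), ?_, ?_, ?_⟩
    · calc _ ≤ F.card * ((j + 1) * d) := by
            refine Finset.card_biUnion_le_card_mul _ _ _ fun t ht => ?_
            refine (Finset.card_biUnion_le_card_mul _ _ d fun u hu => ?_).trans ?_
            · refine Finset.card_image_le.trans ((Finset.card_le_card Finset.sdiff_subset).trans ?_)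
              exact (Finset.mem_filter.1 hu).2
            · gcongr
              exact (Finset.card_filter_le _ _).trans (hcard t ht).2.le
        _ ≤ (j.factorial * d ^ j) * ((j + 1) * d) := by gcongr
        _ = _ := by rw [Nat.factorial_succ]; ring
    · simp only [Finset.mem_biUnion, Finset.mem_image, Finset.mem_sdiff]
      rintro _ ⟨t, ht, u, -, w, ⟨-, hw⟩, rfl⟩
      exact ⟨Finset.mem_insert_of_mem (hcard t ht).1,
        by rw [Finset.card_insert_of_notMem hw, (hcard t ht).2]⟩
    · intro s hconn hv hdeg hj
      obtain ⟨t, ht, hts⟩ := hs s hconn hv hdeg (by omega)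
      obtain ⟨b, hb, hbt⟩ := Finset.exists_mem_notMem_of_card_lt_card
        (show t.card < s.card by rw [(hcard t ht).2]; omega)
      obtain ⟨u, hu, hus, w, hw, hwt, huw⟩ :=
        exists_adj_boundary hconn (t := t) hv (hcard t ht).1 hb hbt
      refine ⟨insert w t, ?_, Finset.insert_subset hw hts⟩
      simp only [Finset.mem_biUnion, Finset.mem_image, Finset.mem_sdiff, Finset.mem_filter]
      exact ⟨t, ht, u, ⟨hu, hdeg u hus⟩, w, ⟨by simpa using huw, hwt⟩, rfl⟩

/-- The number of connected `(j + 1)`-sets containing `v` all of whose vertices have degree at most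
`d`. -/
theorem card_connected_le (v : V) (d j : ℕ) (F : Finset (Finset V))
    (hF : ∀ s ∈ F, (G.induce (s : Set V)).Connected ∧ v ∈ s ∧ (∀ u ∈ s, G.degree u ≤ d) ∧
      s.card = j + 1) : F.card ≤ j.factorial * d ^ j := by
  obtain ⟨F', hF', hcard, hs⟩ := exists_growth_family (G := G) v d j
  refine (Finset.card_le_card fun s hsF => ?_).trans hF'
  obtain ⟨hconn, hv, hdeg, hj⟩ := hF s hsF
  obtain ⟨t, ht, hts⟩ := hs s hconn hv hdeg hj.ge
  rwa [← Finset.eq_of_subset_of_card_le hts (by rw [hj, (hcard t ht).2])]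

/-- A connected set with at least three vertices contains a vertex of degree at least two. -/
theorem exists_two_le_degree {s : Finset V} (hs : (G.induce (s : Set V)).Connected)
    (hcard : 3 ≤ s.card) : ∃ v ∈ s, 2 ≤ G.degree v := by
  obtain ⟨⟨a, ha⟩⟩ := hs.nonempty
  obtain ⟨b, hb, hba⟩ := Finset.exists_mem_notMem_of_card_lt_card
    (show ({a} : Finset V).card < s.card by simp; omega)
  obtain ⟨u, hu, -, b, hb, -, hab⟩ :=
    exists_adj_boundary hs (t := {a}) ha rfl hb (by simpa using hba)
  obtain rfl : a = u := hu.symm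
  obtain ⟨c, hc, hcab⟩ := Finset.exists_mem_notMem_of_card_lt_card
    (show ({a, b} : Finset V).card < s.card from Finset.card_le_two.trans_lt (by omega))
  obtain ⟨x, hx, hxs, c, hc, hcab, hxc⟩ :=
    exists_adj_boundary hs (t := ({a, b} : Finset V)) ha (by simp) hc hcab
  refine ⟨x, hxs, ?_⟩
  have hcab' : c ≠ a ∧ c ≠ b := by simpa using hcab
  rw [← card_neighborFinset_eq_degree]
  refine Nat.succ_le_of_lt (Finset.one_lt_card.2 ?_)
  rcases (by simpa using hx : x = a ∨ x = b) with rfl | rfl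
  · exact ⟨b, by simpa using hab, c, by simpa using hxc, hcab'.2.symm⟩
  · exact ⟨a, by simpa using hab.symm, c, by simpa using hxc, hcab'.1.symm⟩

/-- A connected graph of small maximum degree and small eccentricity is small. -/
theorem card_dist_le (hG : G.Connected) (v : V) {d : ℕ} (hd : ∀ u, G.degree u ≤ d) (r : ℕ) :
    (Finset.univ.filter (G.dist v · ≤ r)).card ≤ (d + 1) ^ r := by
  induction r with
  | zero =>
    rw [pow_zero, Finset.card_le_one]
    simp [hG.preconnected v _]
  | succ r ih =>
    calc _ ≤ ((Finset.univ.filter (G.dist v · ≤ r)).biUnion fun u =>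
          insert u (G.neighborFinset u)).card := by
            refine Finset.card_le_card fun w hw => ?_
            simp only [Finset.mem_filter, Finset.mem_univ, true_and, Finset.mem_biUnion,
              Finset.mem_insert, mem_neighborFinset] at hw ⊢
            rcases hw.lt_or_eq with hw | hw
            · exact ⟨w, by omega, Or.inl rfl⟩
            · obtain ⟨p, hp⟩ := hG.exists_walk_length_eq_dist w v
              cases p with
              | nil => simp at hw
              | cons h q =>
                refine ⟨_, ?_, Or.inr h.symm⟩
                have := dist_le q
                rw [Walk.length_cons, dist_comm, hw] at hp
                rw [dist_comm]; omega
      _ ≤ _ := Finset.card_biUnion_le_card_mul _ _ (d + 1) fun u _ =>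
            (Finset.card_insert_le _ _).trans (by simpa using hd u)
      _ ≤ _ := by rw [pow_succ]; gcongr

end Growth

/-- The binomial lower bound `(n / r) ^ r ≤ n.choose r`, without division. -/
theorem pow_le_choose_mul_pow {n r : ℕ} (h : r ≤ n) : n ^ r ≤ n.choose r * r ^ r := by
  induction r generalizing n with
  | zero => simp
  | succ r ih =>
    obtain ⟨n, rfl⟩ : ∃ m, n = m + 1 := ⟨n - 1, by omega⟩
    rcases r.eq_zero_or_pos with rfl | hr
    · simp
    have h1 := ih (n := n) (by omega)
    have h2 : (n + 1) * r ≤ (r + 1) * n := by nlinarith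
    have h3 := Nat.pow_le_pow_left h2 r
    rw [mul_pow, mul_pow] at h3
    have h4 : (n + 1) ^ r ≤ n.choose r * (r + 1) ^ r := by
      refine Nat.le_of_mul_le_mul_right (c := r ^ r) ?_ (by positivity)
      calc _ ≤ (r + 1) ^ r * n ^ r := h3
        _ ≤ (r + 1) ^ r * (n.choose r * r ^ r) := by gcongr
        _ = _ := by ring
    calc (n + 1) ^ (r + 1) ≤ (n.choose r * (r + 1) ^ r) * (n + 1) := by rw [pow_succ]; gcongr
      _ = ((n + 1) * n.choose r) * (r + 1) ^ r := by ring
      _ = _ := by rw [Nat.add_one_mul_choose_eq]; ring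

theorem factorial_le_pow_sub_two {k : ℕ} (hk : 5 ≤ k) : k.factorial ≤ k ^ (k - 2) := by
  induction k, hk using Nat.le_induction with
  | base => decide
  | succ k hk ih =>
    obtain ⟨m, rfl⟩ : ∃ m, k = m + 2 := ⟨k - 2, by omega⟩
    calc _ = (m + 2 + 1) * (m + 2).factorial := Nat.factorial_succ _
      _ ≤ (m + 2 + 1) * (m + 2 + 1) ^ m := by
        gcongr
        exact ih.trans (Nat.pow_le_pow_left (by omega) _)
      _ = _ := by rw [mul_comm, ← pow_succ]; congr 1

section Tree

variable {V : Type*} {G : SimpleGraph V}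

/-- The distance from the start is injective on the support of a geodesic. -/
theorem injOn_dist_support (hG : G.Connected) {u v : V} (p : G.Walk u v)
    (hp : p.length = G.dist u v) : Set.InjOn (G.dist u) {x | x ∈ p.support} := by
  have key : ∀ i ≤ p.length, G.dist u (p.getVert i) = i := fun i hi => by
    have h1 := dist_le (p.take i)
    have h2 := dist_le (p.drop i)
    have h3 := hG.dist_triangle (u := u) (v := p.getVert i) (w := v)
    rw [Walk.take_length] at h1
    rw [Walk.drop_length] at h2
    omega
  intro x hx y hy hxy
  obtain ⟨i, rfl, hi⟩ := Walk.mem_support_iff_exists_getVert.1 hx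
  obtain ⟨j, rfl, hj⟩ := Walk.mem_support_iff_exists_getVert.1 hy
  rw [key i hi, key j hj] at hxy
  rw [hxy]

theorem card_support_of_length_eq_dist [DecidableEq V] {u v : V} (p : G.Walk u v)
    (hp : p.length = G.dist u v) : p.support.toFinset.card = p.length + 1 := by
  rw [List.toFinset_card_of_nodup (p.isPath_of_length_eq_dist hp).support_nodup,
    Walk.length_support]

theorem connected_induce_support_toFinset [DecidableEq V] {u v : V} (p : G.Walk u v) :
    (G.induce (p.support.toFinset : Set V)).Connected := by
  rw [List.coe_toFinset]
  exact p.connected_induce_support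

theorem parent_unique (hG : G.IsTree) {a w u₁ u₂ : V} (h₁ : G.Adj w u₁) (h₂ : G.Adj w u₂)
    (hd₁ : G.dist a u₁ + 1 = G.dist a w) (hd₂ : G.dist a u₂ + 1 = G.dist a w) : u₁ = u₂ := by
  obtain ⟨p₁, hp₁⟩ := hG.1.exists_walk_length_eq_dist u₁ a
  obtain ⟨p₂, hp₂⟩ := hG.1.exists_walk_length_eq_dist u₂ a
  have hq₁ := (Walk.cons h₁ p₁).isPath_of_length_eq_dist (by
    rw [Walk.length_cons, hp₁, dist_comm, hd₁, dist_comm])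
  have hq₂ := (Walk.cons h₂ p₂).isPath_of_length_eq_dist (by
    rw [Walk.length_cons, hp₂, dist_comm, hd₂, dist_comm])
  have := congrArg (fun q : G.Path w a => q.1.getVert 1)
    ((hG.2.subsingleton_path w a).elim ⟨_, hq₁⟩ ⟨_, hq₂⟩)
  simpa using this

theorem dist_adj_cases (hG : G.IsTree) (a : V) {w u : V} (h : G.Adj w u) :
    G.dist a u = G.dist a w + 1 ∨ G.dist a u + 1 = G.dist a w := by
  have h1 := hG.dist_ne_of_adj a h
  have h2 := h.diff_dist_adj (u := a)
  omega

variable [Fintype V] [DecidableRel G.Adj]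

theorem exists_adj_dist_succ (hG : G.IsTree) (a : V) {w : V} (hw : 2 ≤ G.degree w) :
    ∃ u, G.Adj w u ∧ G.dist a u = G.dist a w + 1 := by
  rw [← card_neighborFinset_eq_degree] at hw
  obtain ⟨u₁, h₁, u₂, h₂, hne⟩ := Finset.one_lt_card.1 hw
  rw [mem_neighborFinset] at h₁ h₂
  rcases dist_adj_cases hG a h₁ with hd₁ | hd₁
  · exact ⟨u₁, h₁, hd₁⟩
  rcases dist_adj_cases hG a h₂ with hd₂ | hd₂
  · exact ⟨u₂, h₂, hd₂⟩
  exact absurd (parent_unique hG h₁ h₂ hd₁ hd₂) hne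

variable [DecidableEq V]

omit [Fintype V] in
/-- In a tree, a set with a large part `P` at pairwise distinct distances from a vertex induces small
degrees. -/
theorem card_filter_adj_le (hG : G.IsTree) {P s : Finset V} {a : V}
    (hinj : Set.InjOn (G.dist a) (P : Set V)) (hPs : P ⊆ s) (x : V) :
    (s.filter (G.Adj x)).card ≤ 2 + (s.card - P.card) := by
  have h1 : (P.filter (G.Adj x)).card ≤ ({G.dist a x + 1, G.dist a x - 1} : Finset ℕ).card := by
    refine Finset.card_le_card_of_injOn (G.dist a) (fun y hy => ?_)
      (hinj.mono (Finset.coe_subset.2 (Finset.filter_subset _ _)))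
    have := dist_adj_cases hG a (Finset.mem_filter.1 hy).2
    simp only [Finset.coe_insert, Finset.coe_singleton, Set.mem_insert_iff,
      Set.mem_singleton_iff]
    omega
  calc _ ≤ (P.filter (G.Adj x) ∪ (s \ P)).card := by
        refine Finset.card_le_card fun y hy => ?_
        by_cases hyP : y ∈ P <;> simp_all
    _ ≤ _ := Finset.card_union_le _ _
    _ ≤ _ := by
      rw [Finset.card_sdiff_of_subset hPs]
      exact Nat.add_le_add_right (h1.trans Finset.card_le_two) _

/-- Every vertex of degree at least two in a large tree lies in a `k`-vertex subtree not isomorphic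
to a given graph that is not a path. -/
theorem exists_connected_not_iso {W : Type*} {S : SimpleGraph W} (hpath : ¬ IsPathlike S)
    (hG : G.IsTree) {k : ℕ} (hk : 2 ≤ k) (hbig : k ^ k ≤ Fintype.card V) {v : V}
    (hv : 2 ≤ G.degree v) (hvk : G.degree v < k) :
    ∃ s : Finset V, v ∈ s ∧ s.card = k ∧ (G.induce (s : Set V)).Connected ∧
      ¬ Nonempty (G.induce (s : Set V) ≃g S) := by
  by_contra! h
  obtain ⟨y, hy⟩ : ∃ y, 2 < ndeg S y := by simpa [IsPathlike] using hpath
  have hdeg : ∀ {P s : Finset V} {a : V}, Set.InjOn (G.dist a) (P : Set V) → P ⊆ s →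
      v ∈ s → s.card = k → (G.induce (s : Set V)).Connected → ∀ z, ndeg S z ≤ 2 + (k - P.card) := by
    intro P s a hinj hPs hvs hs hconn z
    obtain ⟨e⟩ := h s hvs hs hconn
    rw [← e.apply_symm_apply z, ndeg_iso, ndeg_induce, ← hs]
    exact card_filter_adj_le hG hinj hPs _
  have hgeo : ∀ {a b : V} (p : G.Walk a b), p.length = G.dist a b → v ∈ p.support →
      p.length + 1 < k := by
    intro a b p hp hvp
    by_contra! hlen
    have hcard := card_support_of_length_eq_dist p hp
    obtain ⟨s, hvs, hsp, hs, hconn⟩ := exists_connected_between (A := {v})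
      (B := p.support.toFinset) (m := k) (connected_induce_singleton v)
      (connected_induce_support_toFinset p) (by simpa using hvp)
      (by rw [Finset.card_singleton]; omega) (by omega)
    have := hdeg (P := s) (s := s) (a := a)
      ((injOn_dist_support hG.1 p hp).mono fun x hx => by simpa using hsp hx) subset_rfl
      (hvs (Finset.mem_singleton_self _)) hs hconn y
    omega
  obtain ⟨w, hw⟩ : ∃ w, k ≤ G.degree w := by
    by_contra! hsmall
    have := card_dist_le hG.1 v (d := k - 1) (fun u => by have := hsmall u; omega) (k - 2)
    rw [Finset.filter_true_of_mem, Finset.card_univ, Nat.sub_add_cancel (by omega)] at this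
    · have h2 : k ^ (k - 2) < k ^ k := Nat.pow_lt_pow_right (by omega) (by omega)
      omega
    · intro x _
      obtain ⟨p, hp⟩ := hG.1.exists_walk_length_eq_dist v x
      have := hgeo p hp p.start_mem_support
      omega
  have hvw : v ≠ w := by rintro rfl; omega
  obtain ⟨q, hq⟩ := hG.1.exists_walk_length_eq_dist v w
  obtain ⟨v', hvv', hdv'⟩ := exists_adj_dist_succ hG w hv
  obtain ⟨w', hww', hdw'⟩ := exists_adj_dist_succ hG v' (hk.trans hw)
  have hp : (Walk.cons hvv'.symm (q.concat hww')).length = G.dist v' w' := by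
    rw [Walk.length_cons, Walk.length_concat, hq, hdw', SimpleGraph.dist_comm (u := v'), hdv',
      SimpleGraph.dist_comm]
  have hlt := hgeo _ hp (by simp)
  have hpc := card_support_of_length_eq_dist _ hp
  have hqc := card_support_of_length_eq_dist q hq
  obtain ⟨s, hps, -, hs, hconn⟩ := exists_connected_between (m := k)
    (connected_induce_support_toFinset (Walk.cons hvv'.symm (q.concat hww')))
    (B := Finset.univ) (by rw [Finset.coe_univ]; exact induceUnivIso G |>.connected_iff.2 hG.1)
    (Finset.subset_univ _) (by omega)
    (by rw [Finset.card_univ]; exact (Nat.le_self_pow (by omega) k).trans hbig)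
  have hupper := hdeg ((injOn_dist_support hG.1 _ hp).mono
    fun x hx => List.mem_toFinset.1 hx) hps
    (hps (by simp)) hs hconn
  obtain ⟨C, hAC, hCB, hC, hCconn⟩ := exists_connected_between (m := k)
    (connected_induce_support_toFinset q)
    (connected_induce_union_neighbors (connected_induce_support_toFinset q)
      (List.mem_toFinset.2 q.end_mem_support) (G.neighborFinset w) (by simp))
    Finset.subset_union_left (by simp only [Walk.length_cons, Walk.length_concat] at hlt; omega)
    (hw.trans (by
      rw [← card_neighborFinset_eq_degree]; exact Finset.card_le_card Finset.subset_union_right))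
  obtain ⟨e⟩ := h C (hAC (by simp)) hC hCconn
  obtain ⟨w₁, hw₁, -, x, hxq, hxw, hwx⟩ := exists_adj_boundary
    (connected_induce_support_toFinset q) (t := {w}) (a := w) (b := v) (by simp) rfl (by simp) hvw
  rw [Set.mem_singleton_iff.1 hw₁] at hwx
  have hwC : w ∈ (C : Set V) := hAC (by simp)
  have hlow : (insert x (C \ q.support.toFinset)).card ≤ (C.filter (G.Adj w)).card := by
    refine Finset.card_le_card fun z hz => ?_
    rcases Finset.mem_insert.1 hz with rfl | hz
    · exact Finset.mem_filter.2 ⟨hAC hxq, hwx⟩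
    · obtain ⟨hzC, hzq⟩ := Finset.mem_sdiff.1 hz
      exact Finset.mem_filter.2 ⟨hzC, by simpa [hzq] using Finset.mem_union.1 (hCB hzC)⟩
  rw [Finset.card_insert_of_notMem (by simpa using fun _ => hxq), Finset.card_sdiff_of_subset hAC,
    ← ndeg_induce C ⟨w, hwC⟩, ← ndeg_iso e] at hlow
  have := hupper (e ⟨w, hwC⟩)
  simp only [Walk.length_cons, Walk.length_concat] at hlt hpc
  omega

omit [Fintype V] in
/-- A vertex together with some of its neighbours in a tree does not induce a copy of a graph that
is not a star. -/
theorem not_iso_of_not_isStarlike {W : Type*} {S : SimpleGraph W} (hstar : ¬ IsStarlike S)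
    (hG : G.IsTree) {v : V} {t : Finset V} (ht : ∀ w ∈ t, G.Adj v w) :
    ¬ Nonempty (G.induce ((insert v t : Finset V) : Set V) ≃g S) := by
  rintro ⟨e⟩
  refine hstar (Set.subsingleton_of_subset_singleton
    (a := e ⟨v, Finset.mem_insert_self v t⟩) fun y hy => ?_)
  by_contra hyv
  refine hy ?_
  obtain ⟨⟨x, hx⟩, rfl⟩ := e.surjective y
  have hxv : x ≠ v := by rintro rfl; exact hyv rfl
  have hxt : x ∈ t := by simpa [hxv] using hx
  rw [ndeg_iso, ndeg_induce, Finset.card_eq_one]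
  refine ⟨v, ?_⟩
  ext z
  simp only [Finset.mem_filter, Finset.mem_insert, Finset.mem_singleton]
  refine ⟨?_, fun h => ⟨Or.inl h, h ▸ (ht x hxt).symm⟩⟩
  rintro ⟨rfl | hz, hxz⟩
  · rfl
  · refine absurd ?_ (hG.dist_ne_of_adj v hxz)
    rw [dist_eq_one_iff_adj.2 (ht x hxt), dist_eq_one_iff_adj.2 (ht z hz)]

/-- The number of non-copies of `S` through a vertex of degree at least two. -/
theorem pow_degree_le {W : Type*} {S : SimpleGraph W} (hpath : ¬ IsPathlike S)
    (hstar : ¬ IsStarlike S) (hG : G.IsTree) {k : ℕ} (hk : 2 ≤ k)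
    (hbig : k ^ k ≤ Fintype.card V) {v : V} (hv : 2 ≤ G.degree v) (N : Finset (Finset V))
    (hN : ∀ s : Finset V, s.card = k → (G.induce (s : Set V)).Connected →
      ¬ Nonempty (G.induce (s : Set V) ≃g S) → s ∈ N) :
    G.degree v ^ (k - 1) ≤ (N.filter (v ∈ ·)).card * (k - 1) ^ (k - 1) := by
  rcases le_total (G.degree v) (k - 1) with hvk | hvk
  · obtain ⟨s, hvs, hs, hconn, hiso⟩ :=
      exists_connected_not_iso hpath hG hk hbig hv (by omega)
    have : 0 < (N.filter (v ∈ ·)).card :=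
      Finset.card_pos.2 ⟨s, Finset.mem_filter.2 ⟨hN s hs hconn hiso, hvs⟩⟩
    exact (Nat.pow_le_pow_left hvk _).trans (Nat.le_mul_of_pos_left _ this)
  · refine (pow_le_choose_mul_pow hvk).trans (Nat.mul_le_mul_right _ ?_)
    rw [← card_neighborFinset_eq_degree, ← Finset.card_powersetCard]
    have hmem : ∀ t ∈ Finset.powersetCard (k - 1) (G.neighborFinset v),
        (∀ w ∈ t, G.Adj v w) ∧ v ∉ t ∧ t.card = k - 1 := fun t ht => by
      obtain ⟨hsub, hcard⟩ := Finset.mem_powersetCard.1 ht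
      exact ⟨fun w hw => by simpa using hsub hw, fun hvt => by simpa using hsub hvt, hcard⟩
    refine Finset.card_le_card_of_injOn (insert v) (fun t ht => ?_) fun t ht t' ht' htt' => ?_
    · obtain ⟨hadj, hvt, hcard⟩ := hmem t ht
      refine Finset.mem_filter.2 ⟨hN _ ?_ ?_ (not_iso_of_not_isStarlike hstar hG hadj),
        Finset.mem_insert_self _ _⟩
      · rw [Finset.card_insert_of_notMem hvt]; omega
      · exact connected_induce_union_neighbors (A := {v}) (connected_induce_singleton v)
          (Finset.mem_singleton_self v) t hadj
    · rw [← Finset.erase_insert (hmem t ht).2.1, ← Finset.erase_insert (hmem t' ht').2.1]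
      exact congrArg (Finset.erase · v) htt'

/-- The number of `k`-vertex subtrees is at most `k ^ (2 * k - 3)` times the number of those that are
not copies of `S`. -/
theorem card_subtrees_le {W : Type*} {S : SimpleGraph W} (hpath : ¬ IsPathlike S)
    (hstar : ¬ IsStarlike S) (hG : G.IsTree) {k : ℕ} (hk : 5 ≤ k)
    (hbig : k ^ k ≤ Fintype.card V) (Z N : Finset (Finset V))
    (hZ : ∀ s : Finset V, s ∈ Z ↔ s.card = k ∧ (G.induce (s : Set V)).Connected)
    (hN : ∀ s : Finset V, s ∈ N ↔ s ∈ Z ∧ ¬ Nonempty (G.induce (s : Set V) ≃g S)) :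
    Z.card ≤ k ^ (2 * k - 3) * N.card := by
  have hsum : ∑ v, (N.filter (v ∈ ·)).card = N.card * k := by
    refine (Finset.sum_card_bipartiteAbove_eq_sum_card_bipartiteBelow (s := Finset.univ) (t := N)
      (fun v s => v ∈ s)).trans ?_
    refine Finset.sum_const_nat fun s hs => ?_
    rw [Finset.bipartiteBelow, Finset.filter_univ_mem, ((hZ s).1 ((hN s).1 hs).1).1]
  calc Z.card ≤ ((Finset.univ.filter (2 ≤ G.degree ·)).biUnion fun v =>
        Z.filter fun s => v ∈ s ∧ ∀ u ∈ s, G.degree u ≤ G.degree v).card := by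
        refine Finset.card_le_card fun s hs => ?_
        obtain ⟨hcard, hconn⟩ := (hZ s).1 hs
        obtain ⟨u, hu, hu2⟩ := exists_two_le_degree hconn (by omega)
        obtain ⟨v, hv, hmax⟩ := s.exists_max_image (G.degree ·) ⟨u, hu⟩
        simp only [Finset.mem_biUnion, Finset.mem_filter, Finset.mem_univ, true_and]
        exact ⟨v, hu2.trans (hmax u hu), hs, hv, hmax⟩
    _ ≤ ∑ v ∈ Finset.univ.filter (2 ≤ G.degree ·),
        (k - 1).factorial * G.degree v ^ (k - 1) := by
        refine Finset.card_biUnion_le.trans (Finset.sum_le_sum fun v _ => ?_)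
        refine card_connected_le (G := G) v _ (k - 1) _ fun s hs => ?_
        obtain ⟨hs, hv, hmax⟩ := Finset.mem_filter.1 hs
        obtain ⟨hcard, hconn⟩ := (hZ s).1 hs
        exact ⟨hconn, hv, hmax, by omega⟩
    _ ≤ ∑ v ∈ Finset.univ.filter (2 ≤ G.degree ·),
        (k - 1).factorial * ((N.filter (v ∈ ·)).card * (k - 1) ^ (k - 1)) := by
        refine Finset.sum_le_sum fun v hv => Nat.mul_le_mul_left _ ?_
        exact pow_degree_le hpath hstar hG (by omega) hbig (Finset.mem_filter.1 hv).2 N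
          fun s hs hconn hiso => (hN s).2 ⟨(hZ s).2 ⟨hs, hconn⟩, hiso⟩
    _ ≤ ∑ v, (k - 1).factorial * ((N.filter (v ∈ ·)).card * (k - 1) ^ (k - 1)) :=
        Finset.sum_le_sum_of_subset (Finset.filter_subset _ _)
    _ = k.factorial * (k - 1) ^ (k - 1) * N.card := by
        rw [← Finset.mul_sum, ← Finset.sum_mul, hsum, ← Nat.mul_factorial_pred (n := k) (by omega)]
        ring
    _ ≤ k ^ (k - 2) * k ^ (k - 1) * N.card := by
        gcongr
        · exact factorial_le_pow_sub_two hk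
        · omega
    _ = _ := by rw [← pow_add]; congr 2; omega

end Tree

/-- For every k ≥ 5, every k-vertex tree S that is neither a path nor a
star, and every tree T with at least k^k vertices, d(S,T) ≤ 1 - k^(-(2k-3)). -/
theorem density_le_small_trees {V W : Type*} [Fintype V] [Fintype W]
    (k : ℕ) (hk : 5 ≤ k)
    (S : SimpleGraph W) (hS : S.IsTree) (hcard : Fintype.card W = k)
    (hstar : ¬ IsStarlike S) (hpath : ¬ IsPathlike S)
    (T : SimpleGraph V) (hT : T.IsTree) (hbig : k ^ k ≤ Fintype.card V) :
    density S T ≤ 1 - ((k : ℝ) ^ (2 * k - 3))⁻¹ := by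
  classical
  subst hcard
  set k := Fintype.card W
  set Z : Finset (Finset V) :=
    Finset.univ.filter fun s => s.card = k ∧ (T.induce (s : Set V)).Connected
  have hsub : subtreeCount T k = Z.card := by
    rw [subtreeCount, ← Set.ncard_coe_finset]
    congr 1
    ext s : 1
    simp [Z]
  have hemb : embCount T S k =
      (Z.filter fun s : Finset V => Nonempty (T.induce (s : Set V) ≃g S)).card := by
    rw [embCount, ← Set.ncard_coe_finset]
    congr 1
    ext s : 1
    simp only [Set.mem_ofPred_eq, Finset.coe_filter, Finset.mem_filter, Finset.mem_univ, true_and, Z]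
    exact ⟨fun ⟨h, ⟨e⟩⟩ => ⟨⟨h, e.connected_iff.2 hS.1⟩, ⟨e⟩⟩, fun ⟨⟨h, _⟩, e⟩ => ⟨h, e⟩⟩
  have hle := card_subtrees_le hpath hstar hT hk hbig Z
    (Z.filter fun s : Finset V => ¬ Nonempty (T.induce (s : Set V) ≃g S)) (by simp [Z]) (by simp)
  have hadd := Z.card_filter_add_card_filter_not
    (fun s : Finset V => Nonempty (T.induce (s : Set V) ≃g S))
  rw [← hemb] at hadd
  have hpos : (0 : ℝ) < (k : ℝ) ^ (2 * k - 3) := by positivity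
  rw [density, hsub]
  rcases Z.card.eq_zero_or_pos with hZ | hZ
  · rw [hZ, Nat.cast_zero, div_zero, sub_nonneg]
    exact inv_le_one_of_one_le₀ (one_le_pow₀ (by exact_mod_cast (by omega : 1 ≤ k)))
  · have hZ' : (0 : ℝ) < Z.card := by exact_mod_cast hZ
    have hle' : (Z.card : ℝ) ≤ (k : ℝ) ^ (2 * k - 3) * (Z.card - embCount T S k) := by
      rw [← hadd, Nat.cast_add, add_sub_cancel_left, ← Nat.cast_add, hadd]
      exact_mod_cast hle
    have := (inv_mul_le_iff₀ hpos).2 hle'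
    rw [div_le_iff₀ hZ']
    linarith
end

section
/- Every tree T that is not a caterpillar has at least one and at most two hubs. -/
open SimpleGraph Filter

namespace SimpleGraph

variable {V : Type*} {G : SimpleGraph V}

lemma mem_branchSet_symm {v x y : V} (h : y ∈ branchSet G v x) : x ∈ branchSet G v y := by
  obtain ⟨p, hp⟩ := h
  exact ⟨p.reverse, by simpa using hp⟩

lemma mem_branchSet_trans {v x y z : V} (hxy : y ∈ branchSet G v x)
    (hyz : z ∈ branchSet G v y) : z ∈ branchSet G v x := by
  obtain ⟨p, hp⟩ := hxy
  obtain ⟨q, hq⟩ := hyz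
  exact ⟨p.append q, by simp [Walk.mem_support_append_iff, hp, hq]⟩

lemma mem_branchSet_self {v x : V} (h : x ≠ v) : x ∈ branchSet G v x :=
  ⟨Walk.nil, by simpa using h.symm⟩

lemma mem_branchSet_of_adj {v x y : V} (h : G.Adj x y) (hx : x ≠ v) (hy : y ≠ v) :
    y ∈ branchSet G v x :=
  ⟨h.toWalk, by simp [hx.symm, hy.symm]⟩

lemma right_ne_of_mem_branchSet {v x y : V} (h : y ∈ branchSet G v x) : y ≠ v := by
  obtain ⟨p, hp⟩ := h
  rintro rfl
  exact hp p.end_mem_support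

lemma Connected.dist_add_dist_of_notMem_branchSet (hG : G.Connected) {v x y : V}
    (h : y ∉ branchSet G v x) : G.dist x v + G.dist v y = G.dist x y := by
  classical
  obtain ⟨p, hp⟩ := hG.exists_walk_length_eq_dist x y
  have hv : v ∈ p.support := by
    by_contra hv
    exact h ⟨p, hv⟩
  apply le_antisymm _ hG.dist_triangle
  rw [← hp, ← p.take_spec hv, Walk.length_append]
  exact add_le_add (dist_le _) (dist_le _)

lemma Connected.exists_adj_mem_branchSet (hG : G.Connected) {v x : V} (h : x ≠ v) :
    ∃ u, G.Adj v u ∧ x ∈ branchSet G v u := by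
  obtain ⟨p, hp⟩ := (hG v x).exists_isPath
  cases p with
  | nil => exact absurd rfl h
  | cons huv q => exact ⟨_, huv, q, (Walk.cons_isPath_iff _ _).1 hp |>.2⟩

lemma IsTree.length_eq_dist (hG : G.IsTree) {x y : V} {p : G.Walk x y} (hp : p.IsPath) :
    p.length = G.dist x y := by
  obtain ⟨q, hq, hlen⟩ := hG.connected.exists_path_of_dist x y
  rw [← hlen, (hG.existsUnique_path x y).unique hp hq]

lemma IsTree.dist_of_mem_branchSet (hG : G.IsTree) {v u w : V} (h : G.Adj v u)
    (hw : w ∈ branchSet G v u) : G.dist v w = G.dist u w + 1 := by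
  classical
  obtain ⟨p, hp⟩ := hw
  have hq : (Walk.cons h p.bypass).IsPath :=
    (Walk.cons_isPath_iff _ _).2
      ⟨p.bypass_isPath, fun hv => hp (p.support_bypass_subset_support hv)⟩
  rw [← hG.length_eq_dist hq, Walk.length_cons, hG.length_eq_dist p.bypass_isPath]

lemma Connected.dist_of_notMem_branchSet (hG : G.Connected) {v u w : V} (h : G.Adj v u)
    (hw : w ∉ branchSet G v u) : G.dist u w = G.dist v w + 1 := by
  rw [← hG.dist_add_dist_of_notMem_branchSet hw, dist_eq_one_iff_adj.2 h.symm, add_comm]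

/-- A minimizer of the sum of the distances to all vertices is a center. -/
lemma IsTree.exists_isCenter [Fintype V] (hG : G.IsTree) : ∃ c, IsCenter G c := by
  classical
  have := hG.connected.nonempty
  obtain ⟨c, hc⟩ := Finite.exists_min fun v => ∑ w, G.dist v w
  refine ⟨c, fun u hu => ?_⟩
  have hsum : ∑ w, (G.dist u w + (if w ∈ branchSet G c u then 2 else 0)) =
      ∑ w, (G.dist c w + 1) := by
    refine Finset.sum_congr rfl fun w _ => ?_
    split_ifs with hw
    · rw [hG.dist_of_mem_branchSet hu hw]
    · rw [hG.connected.dist_of_notMem_branchSet hu hw]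
  have hcard : (branchSet G c u).ncard = (Finset.univ.filter (· ∈ branchSet G c u)).card := by
    rw [← Set.ncard_coe_finset]
    congr 1
    ext w
    simp
  rw [Finset.sum_add_distrib, Finset.sum_add_distrib, ← Finset.sum_filter, Finset.sum_const,
    ← hcard] at hsum
  simp only [Finset.sum_const, Finset.card_univ, smul_eq_mul] at hsum
  have := hc u
  omega

lemma Connected.eq_or_adj_of_isCenter [Fintype V] (hG : G.Connected) {c d : V}
    (hc : IsCenter G c) (hd : IsCenter G d) : c = d ∨ G.Adj c d := by
  by_contra! hcd
  obtain ⟨hne, hadj⟩ := hcd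
  obtain ⟨u, hu, hdu⟩ := hG.exists_adj_mem_branchSet hne.symm
  obtain ⟨u', hu', hcu'⟩ := hG.exists_adj_mem_branchSet hne
  have hunion : branchSet G c u ∪ branchSet G d u' = Set.univ := by
    refine Set.eq_univ_of_forall fun w => ?_
    by_contra hw
    rw [Set.mem_union, not_or] at hw
    have h1 := hG.dist_add_dist_of_notMem_branchSet
      fun h => hw.1 (mem_branchSet_trans hdu (mem_branchSet_symm (x := w) h))
    have h2 := hG.dist_add_dist_of_notMem_branchSet
      fun h => hw.2 (mem_branchSet_trans hcu' (mem_branchSet_symm (x := w) h))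
    have h3 := hG.pos_dist_of_ne hne
    have h4 := G.dist_comm (u := c) (v := d)
    omega
  have hinter : 0 < (branchSet G c u ∩ branchSet G d u').ncard := by
    rw [Set.ncard_pos]
    refine ⟨u, mem_branchSet_self hu.ne', mem_branchSet_trans hcu' ?_⟩
    exact mem_branchSet_of_adj hu hne fun h => hadj (h ▸ hu)
  have hcard := Set.ncard_union_add_ncard_inter (branchSet G c u) (branchSet G d u')
  rw [hunion, Set.ncard_univ, Nat.card_eq_fintype_card] at hcard
  have := hc u hu
  have := hd u' hu'
  omega

/-- Any three vertices of a finite tree have a median: a vertex separating each two of them. -/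
lemma IsTree.exists_median [Finite V] (hG : G.IsTree) (x y z : V) :
    ∃ m, y ∉ branchSet G m x ∧ z ∉ branchSet G m x ∧ z ∉ branchSet G m y := by
  have := hG.connected.nonempty
  obtain ⟨m, hm⟩ := Finite.exists_min fun v => G.dist v x + G.dist v y + G.dist v z
  have closer : ∀ {a b : V}, b ∈ branchSet G m a → ∃ u,
      G.dist m a = G.dist u a + 1 ∧ G.dist m b = G.dist u b + 1 ∧
      ∀ w, G.dist u w ≤ G.dist m w + 1 := by
    intro a b hab
    obtain ⟨u, hu, hau⟩ :=
      hG.connected.exists_adj_mem_branchSet (right_ne_of_mem_branchSet (mem_branchSet_symm hab))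
    refine ⟨u, hG.dist_of_mem_branchSet hu hau,
      hG.dist_of_mem_branchSet hu (mem_branchSet_trans hau hab), fun w => ?_⟩
    by_cases hw : w ∈ branchSet G m u
    · have := hG.dist_of_mem_branchSet hu hw
      omega
    · exact (hG.connected.dist_of_notMem_branchSet hu hw).le
  refine ⟨m, fun h => ?_, fun h => ?_, fun h => ?_⟩ <;>
  · obtain ⟨u, h1, h2, h3⟩ := closer h
    have := hm u
    have := h3 x
    have := h3 y
    have := h3 z
    omega

lemma nontrivialBranch_of_mem_branchSet [Finite V] {m u v : V} (hu : G.Adj m u)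
    (hv : v ∈ branchSet G m u) (hR : RootsThreeNontrivial G v) : NontrivialBranch G m u := by
  refine ⟨hu, fun h => ?_⟩
  obtain rfl : v = u := by simpa [h] using hv
  obtain ⟨w, hw, hwm⟩ : ∃ w ∈ {w | NontrivialBranch G v w}, w ≠ m :=
    Set.exists_ne_of_one_lt_ncard (lt_of_lt_of_le (by norm_num) hR) m
  have hmem := mem_branchSet_of_adj hw.1 hu.ne' hwm
  rw [h] at hmem
  exact hw.1.ne' hmem

lemma Connected.rootsThreeNontrivial_of_median [Finite V] (hG : G.Connected) {m x y z : V}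
    (hx : RootsThreeNontrivial G x) (hy : RootsThreeNontrivial G y)
    (hz : RootsThreeNontrivial G z) (hxy : y ∉ branchSet G m x)
    (hxz : z ∉ branchSet G m x) (hyz : z ∉ branchSet G m y) : RootsThreeNontrivial G m := by
  by_cases hxm : x = m
  · exact hxm ▸ hx
  by_cases hym : y = m
  · exact hym ▸ hy
  by_cases hzm : z = m
  · exact hzm ▸ hz
  obtain ⟨a, ha, hax⟩ := hG.exists_adj_mem_branchSet hxm
  obtain ⟨b, hb, hby⟩ := hG.exists_adj_mem_branchSet hym
  obtain ⟨c, hc, hcz⟩ := hG.exists_adj_mem_branchSet hzm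
  refine (Set.two_lt_ncard_iff).2 ⟨a, b, c, nontrivialBranch_of_mem_branchSet ha hax hx,
    nontrivialBranch_of_mem_branchSet hb hby hy, nontrivialBranch_of_mem_branchSet hc hcz hz,
    ?_, ?_, ?_⟩
  · rintro rfl
    exact hxy (mem_branchSet_trans (mem_branchSet_symm hax) hby)
  · rintro rfl
    exact hxz (mem_branchSet_trans (mem_branchSet_symm hax) hcz)
  · rintro rfl
    exact hyz (mem_branchSet_trans (mem_branchSet_symm hby) hcz)

/-- A vertex rooting three non-trivial branches does not separate two hubs other than itself,
since the centers nearest to them lie in one branch. -/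
lemma Connected.mem_branchSet_of_isHub [Fintype V] (hG : G.Connected) {m x y : V}
    (hm : RootsThreeNontrivial G m) (hx : IsHub G x) (hy : IsHub G y) (hxm : x ≠ m)
    (hym : y ≠ m) : y ∈ branchSet G m x := by
  obtain ⟨-, c, hc, -, hxc⟩ := hx
  obtain ⟨-, d, hd, -, hyd⟩ := hy
  have hcx : c ∈ branchSet G m x := by
    by_contra h
    exact hxc m (hG.dist_add_dist_of_notMem_branchSet h) hxm.symm hm
  have hdy : d ∈ branchSet G m y := by
    by_contra h
    exact hyd m (hG.dist_add_dist_of_notMem_branchSet h) hym.symm hm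
  refine mem_branchSet_trans hcx (mem_branchSet_trans ?_ (mem_branchSet_symm hdy))
  obtain rfl | hadj := hG.eq_or_adj_of_isCenter hc hd
  · exact mem_branchSet_self (right_ne_of_mem_branchSet hcx)
  · exact mem_branchSet_of_adj hadj (right_ne_of_mem_branchSet hcx)
      (right_ne_of_mem_branchSet hdy)

/-- Among the vertices rooting three non-trivial branches, one nearest to the set of centers
is a hub. -/
lemma IsTree.exists_isHub [Fintype V] (hG : G.IsTree) (h : ∃ v, RootsThreeNontrivial G v) :
    ∃ v, IsHub G v := by
  obtain ⟨v₀, hv₀⟩ := h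
  obtain ⟨c₀, hc₀⟩ := hG.exists_isCenter
  obtain ⟨⟨v, c⟩, ⟨hv, hc⟩, hmin⟩ :=
    Set.exists_min_image {p : V × V | RootsThreeNontrivial G p.1 ∧ IsCenter G p.2}
      (fun p => G.dist p.1 p.2) (Set.toFinite _) ⟨(v₀, c₀), hv₀, hc₀⟩
  refine ⟨v, hv, c, hc, fun c' hc' => hmin (v, c') ⟨hv, hc'⟩, fun w hw hne hR => ?_⟩
  have h1 : G.dist v c ≤ G.dist w c := hmin (w, c) ⟨hR, hc⟩
  have h2 := hG.connected.pos_dist_of_ne hne.symm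
  omega

end SimpleGraph

/-- Every tree that is not a caterpillar has at least one and at most two
hubs. -/
theorem hubs_of_non_caterpillar {V : Type*} [Fintype V]
    (T : SimpleGraph V) (hT : T.IsTree) (hnc : ¬ IsCaterpillar T) :
    1 ≤ {v | IsHub T v}.ncard ∧ {v | IsHub T v}.ncard ≤ 2 := by
  constructor
  · have hR : ∃ v, RootsThreeNontrivial T v := by
      by_contra! h
      exact hnc ⟨hT, fun v => Nat.le_of_lt_succ (not_le.1 (h v))⟩
    exact (Set.ncard_pos (Set.toFinite _)).2 (hT.exists_isHub hR)
  · by_contra! h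
    obtain ⟨x, y, z, hx, hy, hz, hxy, hxz, hyz⟩ := (Set.two_lt_ncard_iff).1 h
    obtain ⟨m, hmxy, hmxz, hmyz⟩ := hT.exists_median x y z
    have hm := hT.connected.rootsThreeNontrivial_of_median hx.1 hy.1 hz.1 hmxy hmxz hmyz
    by_cases hxm : x = m
    · exact hmyz (hT.connected.mem_branchSet_of_isHub hm hy hz (hxm ▸ hxy.symm)
        (hxm ▸ hxz.symm))
    by_cases hym : y = m
    · exact hmxz (hT.connected.mem_branchSet_of_isHub hm hx hz hxm (hym ▸ hyz.symm))
    · exact hmxy (hT.connected.mem_branchSet_of_isHub hm hx hy hxm hym)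
end
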